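/- (Lemma 1) The sum of norms of the Bethe vectors M_n(λ₁,…,λ_n) = (1/Q) Σ_{l=0}^{Q−1} ⟨Ψ_l^n(λ₁,…,λ_n)|Ψ_l^n(λ₁,…,λ_n)⟩ is a symmetric function of the spectral parameters: for every permutation σ of {1,…,n}, M_n(λ_{σ(1)},…,λ_{σ(n)}) = M_n(λ₁,…,λ_n). -/

import Mathlib

open Complex Matrix Finset
open scoped Kronecker

noncomputable section

/-- Jacobi theta function `θ₁(z|τ) = -i ∑_{n∈ℤ} (-1)^n exp(πi(n+1/2)²τ + (2n+1)iz)`. -/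
def theta1 (z τ : ℂ) : ℂ :=
  ∑' n : ℤ, -Complex.I * (-1 : ℂ) ^ n *
    Complex.exp ((Real.pi : ℂ) * Complex.I * ((n : ℂ) + 1 / 2) ^ 2 * τ +
      (2 * (n : ℂ) + 1) * Complex.I * z)

/-- Jacobi theta function `θ₄(z|τ) = ∑_{n∈ℤ} (-1)^n exp(πin²τ + 2inz)`. -/
def theta4 (z τ : ℂ) : ℂ :=
  ∑' n : ℤ, (-1 : ℂ) ^ n *
    Complex.exp ((Real.pi : ℂ) * Complex.I * (n : ℂ) ^ 2 * τ +
      2 * (n : ℂ) * Complex.I * z)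

/-- `H(μ) = θ₁(πμ/2K | iK'/K)`, the Jacobi theta function with quasi-periods 2K, 2iK'. -/
def HJ (K K' μ : ℂ) : ℂ := theta1 ((Real.pi : ℂ) * μ / (2 * K)) (Complex.I * K' / K)

/-- `Θ(μ) = θ₄(πμ/2K | iK'/K)`. -/
def ΘJ (K K' μ : ℂ) : ℂ := theta4 ((Real.pi : ℂ) * μ / (2 * K)) (Complex.I * K' / K)

/-- `g(μ) = H(μ)Θ(μ)`. -/
def gJ (K K' μ : ℂ) : ℂ := HJ K K' μ * ΘJ K K' μ

/-- `h(μ) = g(μ)Θ(0)`. -/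
def hJ (K K' μ : ℂ) : ℂ := gJ K K' μ * ΘJ K K' 0

/-- `τ_k = (s+t)/2 + 2kη − K`. -/
def τJ (K η s t : ℂ) (k : ℤ) : ℂ := (s + t) / 2 + 2 * (k : ℂ) * η - K

/-- `α(λ,μ) = h(λ−μ−2η)/h(λ−μ)`. -/
def αJ (K K' η lam mu : ℂ) : ℂ := hJ K K' (lam - mu - 2 * η) / hJ K K' (lam - mu)

/-- `β_k(λ,μ) = (h(2η)/h(μ−λ))·(h(τ_k+μ−λ)/h(τ_k))`. -/
def βJ (K K' η s t : ℂ) (k : ℤ) (lam mu : ℂ) : ℂ :=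
  hJ K K' (2 * η) / hJ K K' (mu - lam) *
    (hJ K K' (τJ K η s t k + mu - lam) / hJ K K' (τJ K η s t k))

/-- Pauli matrices. -/
def σx : Matrix (Fin 2) (Fin 2) ℂ := !![0, 1; 1, 0]
def σy : Matrix (Fin 2) (Fin 2) ℂ := !![0, -Complex.I; Complex.I, 0]
def σz : Matrix (Fin 2) (Fin 2) ℂ := !![1, 0; 0, -1]

/-- `w₄+w₃ = Θ(2η)Θ(μ−η)H(μ+η)` etc. -/
def w4p3 (K K' η μ : ℂ) : ℂ := ΘJ K K' (2 * η) * ΘJ K K' (μ - η) * HJ K K' (μ + η)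
def w4m3 (K K' η μ : ℂ) : ℂ := ΘJ K K' (2 * η) * HJ K K' (μ - η) * ΘJ K K' (μ + η)
def w1p2 (K K' η μ : ℂ) : ℂ := HJ K K' (2 * η) * ΘJ K K' (μ - η) * ΘJ K K' (μ + η)
def w1m2 (K K' η μ : ℂ) : ℂ := HJ K K' (2 * η) * HJ K K' (μ - η) * HJ K K' (μ + η)
def wc4 (K K' η μ : ℂ) : ℂ := (w4p3 K K' η μ + w4m3 K K' η μ) / 2
def wc3 (K K' η μ : ℂ) : ℂ := (w4p3 K K' η μ - w4m3 K K' η μ) / 2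
def wc1 (K K' η μ : ℂ) : ℂ := (w1p2 K K' η μ + w1m2 K K' η μ) / 2
def wc2 (K K' η μ : ℂ) : ℂ := (w1p2 K K' η μ - w1m2 K K' η μ) / 2

/-- The single-site `L`-operator, a 2×2 matrix in auxiliary space whose entries are
operators (2×2 matrices) on the site Hilbert space ℂ². -/
def Lsite (K K' η μ : ℂ) : Matrix (Fin 2) (Fin 2) (Matrix (Fin 2) (Fin 2) ℂ) :=
  !![wc4 K K' η μ • (1 : Matrix (Fin 2) (Fin 2) ℂ) + wc3 K K' η μ • σz,
      wc1 K K' η μ • σx - (Complex.I * wc2 K K' η μ) • σy;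
      wc1 K K' η μ • σx + (Complex.I * wc2 K K' η μ) • σy,
      wc4 K K' η μ • (1 : Matrix (Fin 2) (Fin 2) ℂ) - wc3 K K' η μ • σz]

/-- Entries of the R-matrix. -/
def aJ (K K' η lam mu : ℂ) : ℂ := ΘJ K K' (2*η) * ΘJ K K' (lam - mu) * HJ K K' (lam - mu + 2*η)
def bJ (K K' η lam mu : ℂ) : ℂ := HJ K K' (2*η) * ΘJ K K' (lam - mu) * ΘJ K K' (lam - mu + 2*η)
def cJ (K K' η lam mu : ℂ) : ℂ := ΘJ K K' (2*η) * HJ K K' (lam - mu) * ΘJ K K' (lam - mu + 2*η)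
def dJ (K K' η lam mu : ℂ) : ℂ := HJ K K' (2*η) * HJ K K' (lam - mu) * HJ K K' (lam - mu + 2*η)

/-- The 4×4 R-matrix, with rows/columns indexed by `Fin 2 × Fin 2`
(the basis order (0,0),(0,1),(1,0),(1,1) corresponds to rows 1,2,3,4):
nonzero entries R₁₁ = R₄₄ = a, R₂₂ = R₃₃ = b, R₂₃ = R₃₂ = c, R₁₄ = R₄₁ = d. -/
def Rc (K K' η lam mu : ℂ) : Matrix (Fin 2 × Fin 2) (Fin 2 × Fin 2) ℂ :=
  Matrix.of fun p q =>
    if p = q then (if p.1 = p.2 then aJ K K' η lam mu else bJ K K' η lam mu)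
    else if q = (p.2, p.1) ∧ p.1 ≠ p.2 then cJ K K' η lam mu
    else if p.1 = p.2 ∧ q.1 = q.2 then dJ K K' η lam mu
    else 0

/-- Spin configurations of a chain of length L: the index set of the basis of (ℂ²)^{⊗L}. -/
abbrev Conf (L : ℕ) := Fin L → Fin 2

/-- Operators on (ℂ²)^{⊗L}. -/
abbrev OpC (L : ℕ) := Matrix (Conf L) (Conf L) ℂ

/-- Embedding of a one-site operator at site `n` of the chain (identity elsewhere). -/
def embed (L : ℕ) (n : Fin L) (A : Matrix (Fin 2) (Fin 2) ℂ) : OpC L :=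
  Matrix.of fun f g => A (f n) (g n) * ∏ m ∈ univ.erase n, if f m = g m then 1 else 0

/-- The `L`-operator at site `n`, entries acting on (ℂ²)^{⊗L}. -/
def Lop (K K' η : ℂ) (L : ℕ) (n : Fin L) (μ : ℂ) : Matrix (Fin 2) (Fin 2) (OpC L) :=
  (Lsite K K' η μ).map (embed L n)

/-- The monodromy matrix `T(μ) = L_L(μ)···L_1(μ)` (site n = i+1 for `i : Fin L`). -/
def Tm (K K' η : ℂ) (L : ℕ) (μ : ℂ) : Matrix (Fin 2) (Fin 2) (OpC L) :=
  (List.ofFn fun i : Fin L => Lop K K' η L i.rev μ).prod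

def Amat (K K' η : ℂ) (L : ℕ) (μ : ℂ) : OpC L := Tm K K' η L μ 0 0
def Bmat (K K' η : ℂ) (L : ℕ) (μ : ℂ) : OpC L := Tm K K' η L μ 0 1
def Cmat (K K' η : ℂ) (L : ℕ) (μ : ℂ) : OpC L := Tm K K' η L μ 1 0
def Dmat (K K' η : ℂ) (L : ℕ) (μ : ℂ) : OpC L := Tm K K' η L μ 1 1

/-- The gauge matrix `M_k(μ)`. -/
def Mg (K K' η s t : ℂ) (k : ℤ) (μ : ℂ) : Matrix (Fin 2) (Fin 2) ℂ :=
  !![HJ K K' (s + 2 * (k : ℂ) * η - μ), (gJ K K' (τJ K η s t k))⁻¹ * HJ K K' (t + 2 * (k : ℂ) * η + μ);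
     ΘJ K K' (s + 2 * (k : ℂ) * η - μ), (gJ K K' (τJ K η s t k))⁻¹ * ΘJ K K' (t + 2 * (k : ℂ) * η + μ)]

/-- View a scalar 2×2 matrix as a 2×2 matrix of operators on (ℂ²)^{⊗L}. -/
def toOp (L : ℕ) (A : Matrix (Fin 2) (Fin 2) ℂ) : Matrix (Fin 2) (Fin 2) (OpC L) :=
  A.map fun z => z • (1 : OpC L)

/-- View a scalar 2×2 matrix as a 2×2 matrix of one-site operators. -/
def toOp2 (A : Matrix (Fin 2) (Fin 2) ℂ) : Matrix (Fin 2) (Fin 2) (Matrix (Fin 2) (Fin 2) ℂ) :=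
  A.map fun z => z • (1 : Matrix (Fin 2) (Fin 2) ℂ)

/-- The gauge-transformed monodromy matrix `T_{k,l}(μ) = M_k(μ)⁻¹ T(μ) M_l(μ)`. -/
def Tg (K K' η s t : ℂ) (L : ℕ) (k l : ℤ) (μ : ℂ) : Matrix (Fin 2) (Fin 2) (OpC L) :=
  toOp L (Mg K K' η s t k μ)⁻¹ * Tm K K' η L μ * toOp L (Mg K K' η s t l μ)

def Ag (K K' η s t : ℂ) (L : ℕ) (k l : ℤ) (μ : ℂ) : OpC L := Tg K K' η s t L k l μ 0 0
def Bg (K K' η s t : ℂ) (L : ℕ) (k l : ℤ) (μ : ℂ) : OpC L := Tg K K' η s t L k l μ 0 1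
def Cg (K K' η s t : ℂ) (L : ℕ) (k l : ℤ) (μ : ℂ) : OpC L := Tg K K' η s t L k l μ 1 0
def Dg (K K' η s t : ℂ) (L : ℕ) (k l : ℤ) (μ : ℂ) : OpC L := Tg K K' η s t L k l μ 1 1

/-- The gauge-transformed one-site L-operator `L_n^l(μ) = M_{n+l}(μ)⁻¹ L_n(μ) M_{n+l−1}(μ)`. -/
def Lg (K K' η s t : ℂ) (n l : ℤ) (μ : ℂ) : Matrix (Fin 2) (Fin 2) (Matrix (Fin 2) (Fin 2) ℂ) :=
  toOp2 (Mg K K' η s t (n + l) μ)⁻¹ * Lsite K K' η μ * toOp2 (Mg K K' η s t (n + l - 1) μ)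

/-- The local vacuum `|ω_n^l⟩` (depending on n, l only through nl = n + l):
`H(s+(2(n+l)−1)η)|↑⟩ + Θ(s+(2(n+l)−1)η)|↓⟩`. -/
def ωvec (K K' η s : ℂ) (nl : ℤ) : Fin 2 → ℂ :=
  ![HJ K K' (s + (2 * (nl : ℂ) - 1) * η), ΘJ K K' (s + (2 * (nl : ℂ) - 1) * η)]

/-- The dual local vacuum `⟨ω_n^l| = Θ(t+(2(n+l)−1)η)⟨↑| − H(t+(2(n+l)−1)η)⟨↓|`. -/
def ωdual (K K' η t : ℂ) (nl : ℤ) : Fin 2 → ℂ :=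
  ![ΘJ K K' (t + (2 * (nl : ℂ) - 1) * η), -HJ K K' (t + (2 * (nl : ℂ) - 1) * η)]

/-- The generating vector `|l⟩ = |ω_L^l⟩⊗···⊗|ω_1^l⟩` (site n = i+1). -/
def genV (K K' η s : ℂ) (L : ℕ) (l : ℤ) : Conf L → ℂ :=
  fun f => ∏ i : Fin L, ωvec K K' η s ((i : ℕ) + 1 + l) (f i)

/-- The dual generating vector `⟨l| = ⟨ω_1^l|⊗···⊗⟨ω_L^l|`. -/
def genD (K K' η t : ℂ) (L : ℕ) (l : ℤ) : Conf L → ℂ :=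
  fun f => ∏ i : Fin L, ωdual K K' η t ((i : ℕ) + 1 + l) (f i)

/-- The n-particle Bethe vector
`|Ψ_l^n(λ₁,…,λ_n)⟩ = B_{l+N−n+1,l−N+n−1}(λ₁)···B_{l+N,l−N}(λ_n)|l−N⟩`
(for n = N this is `|Ψ_l(λ₁,…,λ_N)⟩ = B_{l+1,l−1}(λ₁)···B_{l+N,l−N}(λ_N)|l−N⟩`). -/
def psiB (K K' η s t : ℂ) (L N n : ℕ) (l : ℤ) (lam : Fin n → ℂ) : Conf L → ℂ :=
  ((List.ofFn fun j : Fin n =>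
      Bg K K' η s t L (l + (N : ℤ) - (n : ℤ) + 1 + (j : ℕ)) (l - (N : ℤ) + (n : ℤ) - 1 - (j : ℕ))
        (lam j)).prod).mulVec
    (genV K K' η s L (l - (N : ℤ)))

/-- The dual n-particle Bethe vector
`⟨Ψ_l^n(λ₁,…,λ_n)| = ⟨l−N+1| C_{l+N−1,l−N+1}(λ_n)···C_{l+N−n,l−N+n}(λ₁)`. -/
def psiC (K K' η s t : ℂ) (L N n : ℕ) (l : ℤ) (lam : Fin n → ℂ) : Conf L → ℂ :=
  Matrix.vecMul (genD K K' η t L (l - (N : ℤ) + 1))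
    ((List.ofFn fun j : Fin n =>
        Cg K K' η s t L (l + (N : ℤ) - 1 - (j : ℕ)) (l - (N : ℤ) + 1 + (j : ℕ))
          (lam j.rev)).prod)

/-- `r(λ) = (h(λ+η)/h(λ−η))^L`. -/
def rJ (K K' η : ℂ) (L : ℕ) (lam : ℂ) : ℂ := (hJ K K' (lam + η) / hJ K K' (lam - η)) ^ L

/-- The eigenvalue `Λ_m(μ;{λ_k})`. -/
def ΛJ (K K' η : ℂ) (L Q m : ℕ) {n : ℕ} (lam : Fin n → ℂ) (μ : ℂ) : ℂ :=
  Complex.exp (2 * (Real.pi : ℂ) * Complex.I * (m : ℂ) / (Q : ℂ)) *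
      ((hJ K K' (μ + η)) ^ L * ∏ k, αJ K K' η μ (lam k)) +
    Complex.exp (-(2 * (Real.pi : ℂ) * Complex.I * (m : ℂ) / (Q : ℂ))) *
      ((hJ K K' (μ - η)) ^ L * ∏ k, αJ K K' η (lam k) μ)

/-- The sum of norms of the Bethe vectors
`M_n(λ₁,…,λ_n) = (1/Q) Σ_{l=0}^{Q−1} ⟨Ψ_l^n(λ)|Ψ_l^n(λ)⟩`. -/
def MnS (K K' η s t : ℂ) (Q L N n : ℕ) (lam : Fin n → ℂ) : ℂ :=
  (Q : ℂ)⁻¹ * ∑ l ∈ Finset.range Q,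
    dotProduct (psiC K K' η s t L N n (l : ℤ) lam) (psiB K K' η s t L N n (l : ℤ) lam)

/-- `c_L = ⟨l|l−1⟩` (evaluated at l = 0, being independent of l). -/
def cLJ (K K' η s t : ℂ) (L : ℕ) : ℂ :=
  dotProduct (genD K K' η t L 0) (genV K K' η s L (-1))

/-- The eigenvector `|Φ_m⟩ = (1/√Q) Σ_{l=0}^{Q−1} e^{2πilm/Q} |Ψ_l⟩`. -/
def PhiV (K K' η s t : ℂ) (Q L N m : ℕ) (lam : Fin N → ℂ) : Conf L → ℂ :=
  ((Real.sqrt Q : ℝ) : ℂ)⁻¹ • ∑ l ∈ Finset.range Q,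
    Complex.exp (2 * (Real.pi : ℂ) * Complex.I * (l : ℂ) * (m : ℂ) / (Q : ℂ)) •
      psiB K K' η s t L N N (l : ℤ) lam

/-- The dual eigenvector `⟨Φ_m| = (1/√Q) Σ_{l=0}^{Q−1} e^{−2πilm/Q} ⟨Ψ_l|`. -/
def PhiD (K K' η s t : ℂ) (Q L N m : ℕ) (lam : Fin N → ℂ) : Conf L → ℂ :=
  ((Real.sqrt Q : ℝ) : ℂ)⁻¹ • ∑ l ∈ Finset.range Q,
    Complex.exp (-(2 * (Real.pi : ℂ) * Complex.I * (l : ℂ) * (m : ℂ) / (Q : ℂ))) •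
      psiC K K' η s t L N N (l : ℤ) lam

/-- `φ_k = log( r(λ_k) ∏_{i≠k} α(λ_k,λ_i)/α(λ_i,λ_k) )`. -/
def phiG (K K' η : ℂ) (L : ℕ) {n : ℕ} (lam : Fin n → ℂ) (k : Fin n) : ℂ :=
  Complex.log (rJ K K' η L (lam k) *
    ∏ i ∈ univ.erase k, αJ K K' η (lam k) (lam i) / αJ K K' η (lam i) (lam k))



/-- General theta term. -/
def ttm (a z τ : ℂ) (n : ℤ) : ℂ :=
  Complex.exp ((Real.pi : ℂ) * Complex.I * ((n : ℂ) + a) ^ 2 * τ + 2 * ((n : ℂ) + a) * Complex.I * z)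

theorem ttm_eq (a z τ : ℂ) (n : ℤ) : ttm a z τ n =
    Complex.exp ((Real.pi : ℂ) * Complex.I * a ^ 2 * τ + 2 * a * Complex.I * z) *
      jacobiTheta₂_term n (z / (Real.pi : ℂ) + a * τ) τ := by
  have hpi : (Real.pi : ℂ) ≠ 0 := by exact_mod_cast Real.pi_ne_zero
  unfold ttm jacobiTheta₂_term
  rw [← Complex.exp_add]
  congr 1
  field_simp
  ring

theorem ttm_summable (a z : ℂ) {τ : ℂ} (hτ : 0 < τ.im) : Summable (ttm a z τ) := by
  have : ttm a z τ = fun n => Complex.exp ((Real.pi : ℂ) * Complex.I * a ^ 2 * τ + 2 * a * Complex.I * z) *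
      jacobiTheta₂_term n (z / (Real.pi : ℂ) + a * τ) τ := by
    funext n; exact ttm_eq a z τ n
  rw [this]
  exact ((summable_jacobiTheta₂_term_iff _ _).mpr hτ).mul_left _

theorem sgn_norm (n : ℤ) : ‖((-1 : ℂ) ^ n)‖ = 1 := by simp

theorem sttm_summable_norm (c a z : ℂ) {τ : ℂ} (hτ : 0 < τ.im) :
    Summable (fun n => ‖c * (-1 : ℂ) ^ n * ttm a z τ n‖) := by
  have := ((ttm_summable a z hτ).norm).mul_left ‖c‖
  refine this.congr fun n => ?_
  rw [norm_mul, norm_mul, sgn_norm, mul_one]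

theorem theta1_ttm (z τ : ℂ) :
    theta1 z τ = ∑' n : ℤ, -Complex.I * (-1 : ℂ) ^ n * ttm (1/2) z τ n := by
  unfold theta1 ttm
  refine tsum_congr fun n => ?_
  congr 2; ring

theorem theta4_ttm (z τ : ℂ) :
    theta4 z τ = ∑' n : ℤ, 1 * (-1 : ℂ) ^ n * ttm 0 z τ n := by
  unfold theta4 ttm
  refine tsum_congr fun n => ?_
  rw [one_mul]
  congr 2; ring

/-- parity equivalence -/
def parE : (ℤ × ℤ) ⊕ (ℤ × ℤ) ≃ ℤ × ℤ where
  toFun := Sum.elim (fun p => (p.1 + p.2, p.1 - p.2)) (fun p => (p.1 + p.2 + 1, p.1 - p.2))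
  invFun := fun p => if (p.1 + p.2) % 2 = 0 then Sum.inl ((p.1 + p.2) / 2, (p.1 - p.2) / 2)
    else Sum.inr ((p.1 + p.2 - 1) / 2, (p.1 - p.2 - 1) / 2)
  left_inv := by
    rintro (⟨a, b⟩ | ⟨a, b⟩)
    · have : (a + b + (a - b)) % 2 = 0 := by omega
      simp only [Sum.elim_inl, this, if_true]
      congr 2 <;> omega
    · have : (a + b + 1 + (a - b)) % 2 ≠ 0 := by omega
      simp only [Sum.elim_inr, this, if_false]
      congr 2 <;> omega
  right_inv := by
    rintro ⟨a, b⟩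
    by_cases h : (a + b) % 2 = 0
    · simp only [h, if_true, Sum.elim_inl]
      ext <;> simp only <;> omega
    · simp only [h, if_false, Sum.elim_inr]
      ext <;> simp only <;> omega

theorem parity_tsum (F : ℤ × ℤ → ℂ) (hF : Summable F) :
    ∑' p, F p = ∑' p : ℤ × ℤ, F (p.1 + p.2, p.1 - p.2) + ∑' p : ℤ × ℤ, F (p.1 + p.2 + 1, p.1 - p.2) := by
  have h : Summable (F ∘ parE) := (Equiv.summable_iff parE).mpr hF
  rw [← Equiv.tsum_eq parE F]
  have h1 : Summable (fun p : ℤ × ℤ => F (p.1 + p.2, p.1 - p.2)) :=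
    h.comp_injective (i := Sum.inl) Sum.inl_injective
  have h2 : Summable (fun p : ℤ × ℤ => F (p.1 + p.2 + 1, p.1 - p.2)) :=
    h.comp_injective (i := Sum.inr) Sum.inr_injective
  exact (HasSum.sum (f := F ∘ parE) h1.hasSum h2.hasSum).tsum_eq

theorem mul_tsum_parity (f g : ℤ → ℂ) (hf : Summable fun n => ‖f n‖) (hg : Summable fun n => ‖g n‖) :
    (∑' n, f n) * (∑' n, g n) = ∑' p : ℤ × ℤ, f (p.1 + p.2) * g (p.1 - p.2)
      + ∑' p : ℤ × ℤ, f (p.1 + p.2 + 1) * g (p.1 - p.2) := by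
  rw [tsum_mul_tsum_of_summable_norm hf hg,
    parity_tsum (fun p => f p.1 * g p.2) (summable_mul_of_summable_norm hf hg)]

def thA (z τ : ℂ) : ℂ := ∑' n : ℤ, ttm 0 z (2 * τ) n
def thB (z τ : ℂ) : ℂ := ∑' n : ℤ, ttm (1/2) z (2 * τ) n

theorem two_im {τ : ℂ} (hτ : 0 < τ.im) : 0 < (2 * τ).im := by simpa using hτ

theorem thA_neg (z τ : ℂ) : thA (-z) τ = thA z τ := by
  unfold thA
  rw [← Equiv.tsum_eq (Equiv.neg ℤ)]
  refine tsum_congr fun n => ?_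
  unfold ttm; congr 1; simp

theorem thB_neg (z τ : ℂ) : thB (-z) τ = thB z τ := by
  unfold thB
  rw [← Equiv.tsum_eq ((Equiv.neg ℤ).trans (Equiv.addRight (-1)))]
  refine tsum_congr fun n => ?_
  unfold ttm; congr 1; simp; ring

theorem neg_one_sq_zpow (a b : ℤ) (h : (a + b) % 2 = 0) : (-1 : ℂ) ^ a * (-1 : ℂ) ^ b = 1 := by
  rw [← zpow_add₀ (by norm_num)]
  exact Even.neg_one_zpow (Int.even_iff.mpr h)

theorem neg_one_odd_zpow (a b : ℤ) (h : (a + b) % 2 = 1) : (-1 : ℂ) ^ a * (-1 : ℂ) ^ b = -1 := by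
  rw [← zpow_add₀ (by norm_num)]
  exact Odd.neg_one_zpow (Int.odd_iff.mpr h)

theorem neg_one_zpow_congr (a b : ℤ) (h : (a - b) % 2 = 0) : (-1 : ℂ) ^ a = (-1 : ℂ) ^ b := by
  obtain ⟨k, hk⟩ := Int.even_iff.mpr h
  have : a = b + (k + k) := by omega
  rw [this, zpow_add₀ (by norm_num), Even.neg_one_zpow ⟨k, rfl⟩, mul_one]

theorem sgn_mul (c c' x y : ℂ) (m n : ℤ) :
   (c * (-1 : ℂ) ^ m * x) * (c' * (-1 : ℂ) ^ n * y) = (c * c') * ((-1 : ℂ) ^ m * (-1 : ℂ) ^ n) * (x * y) := by ring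

theorem prod_tsum (f g : ℤ → ℂ) (hf : Summable f) (hg : Summable g) :
    ∑' p : ℤ × ℤ, f p.1 * g p.2 = (∑' n, f n) * (∑' n, g n) :=
  (tsum_mul_tsum_of_summable_norm hf.norm hg.norm).symm

theorem t44 (x y : ℂ) {τ : ℂ} (hτ : 0 < τ.im) : theta4 x τ * theta4 y τ =
    thA (x + y) τ * thA (x - y) τ - thB (x + y) τ * thB (x - y) τ := by
  rw [theta4_ttm, theta4_ttm, mul_tsum_parity _ _ (sttm_summable_norm _ _ _ hτ) (sttm_summable_norm _ _ _ hτ)]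
  unfold thA thB
  rw [← prod_tsum _ _ (ttm_summable _ _ (two_im hτ)) (ttm_summable _ _ (two_im hτ)),
    ← prod_tsum _ _ (ttm_summable _ _ (two_im hτ)) (ttm_summable _ _ (two_im hτ)), sub_eq_add_neg, ← tsum_neg]
  congr 1
  · refine tsum_congr fun p => ?_
    rw [sgn_mul, neg_one_sq_zpow _ _ (by omega)]
    unfold ttm
    rw [← Complex.exp_add, ← Complex.exp_add, one_mul, one_mul, one_mul]
    congr 1; push_cast; ring
  · refine tsum_congr fun p => ?_
    rw [sgn_mul, neg_one_odd_zpow _ _ (by omega)]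
    unfold ttm
    rw [← Complex.exp_add, ← Complex.exp_add, one_mul, one_mul, neg_one_mul]
    congr 2; push_cast; ring

theorem t11 (x y : ℂ) {τ : ℂ} (hτ : 0 < τ.im) : theta1 x τ * theta1 y τ =
    thA (x + y) τ * thB (x - y) τ - thB (x + y) τ * thA (x - y) τ := by
  rw [theta1_ttm, theta1_ttm, mul_tsum_parity _ _ (sttm_summable_norm _ _ _ hτ) (sttm_summable_norm _ _ _ hτ)]
  have hsh : ∀ f : ℤ → ℂ, ∑' n, f n = ∑' n, f (n + 1) := fun f =>
    (Equiv.tsum_eq (Equiv.addRight (1:ℤ)) f).symm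
  unfold thA thB
  rw [hsh (ttm 0 (x + y) (2 * τ)),
    ← prod_tsum (fun n => ttm 0 (x + y) (2 * τ) (n + 1)) _
      ((Equiv.summable_iff (Equiv.addRight (1:ℤ))).mpr (ttm_summable _ _ (two_im hτ))) (ttm_summable _ _ (two_im hτ)),
    ← prod_tsum _ _ (ttm_summable _ _ (two_im hτ)) (ttm_summable _ _ (two_im hτ)), sub_eq_add_neg, ← tsum_neg, add_comm]
  congr 1
  · refine tsum_congr fun p => ?_
    rw [sgn_mul, neg_one_odd_zpow _ _ (by omega)]
    unfold ttm
    rw [← Complex.exp_add, ← Complex.exp_add, neg_mul_neg, Complex.I_mul_I, neg_mul_neg, one_mul, one_mul]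
    congr 1; push_cast; ring
  · refine tsum_congr fun p => ?_
    rw [sgn_mul, neg_one_sq_zpow _ _ (by omega)]
    unfold ttm
    rw [← Complex.exp_add, ← Complex.exp_add, neg_mul_neg, Complex.I_mul_I, mul_one, neg_one_mul]
    congr 2; push_cast; ring

/-- half-modulus functions -/
def thF (z τ : ℂ) : ℂ := ∑' n : ℤ, ttm (1/2) (z / 2) (τ / 2) n
def thf (z τ : ℂ) : ℂ := ∑' n : ℤ, -Complex.I * (-1 : ℂ) ^ n * ttm (1/2) (z / 2) (τ / 2) n

theorem half_im {τ : ℂ} (hτ : 0 < τ.im) : 0 < (τ / 2).im := by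
  have : (τ / 2).im = τ.im / 2 := by simp
  rw [this]; linarith

theorem tdet (x y : ℂ) {τ : ℂ} (hτ : 0 < τ.im) : theta1 x τ * theta4 y τ - theta4 x τ * theta1 y τ =
    thF (x + y) τ * thf (x - y) τ := by
  have hsh : ∀ f : ℤ → ℂ, ∑' n, f n = ∑' n, f (n + 1) := fun f =>
    (Equiv.tsum_eq (Equiv.addRight (1:ℤ)) f).symm
  have hs1 : Summable (fun n : ℤ => ‖1 * (-1 : ℂ) ^ (n + 1) * ttm 0 x τ (n + 1)‖) :=
    (sttm_summable_norm 1 0 x hτ).comp_injective (add_left_injective (1 : ℤ))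
  have hm := tsum_mul_tsum_of_summable_norm hs1 (sttm_summable_norm (-Complex.I) (1 / 2) y hτ)
  have hm2 := tsum_mul_tsum_of_summable_norm (sttm_summable_norm (-Complex.I) (1 / 2) x hτ)
    (sttm_summable_norm 1 0 y hτ)
  unfold thF thf
  rw [mul_tsum_parity _ _ ((ttm_summable _ _ (half_im hτ)).norm) (sttm_summable_norm _ _ _ (half_im hτ)),
    theta4_ttm x, hsh (fun n => 1 * (-1 : ℂ) ^ n * ttm 0 x τ n), theta4_ttm, theta1_ttm, theta1_ttm,
    hm, hm2,
    sub_eq_add_neg, ← tsum_neg]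
  congr 1
  · refine tsum_congr fun p => ?_
    rw [sgn_mul, ← zpow_add₀ (by norm_num), neg_one_zpow_congr (p.1 + p.2) (p.1 - p.2) (by omega),
      mul_left_comm (ttm _ _ _ _) _ (ttm _ _ _ _)]
    unfold ttm
    rw [← Complex.exp_add, ← Complex.exp_add, mul_one]
    congr 2; push_cast; ring
  · refine tsum_congr fun p => ?_
    rw [sgn_mul, ← zpow_add₀ (by norm_num), neg_one_zpow_congr (p.1 + 1 + p.2) (p.1 - p.2 + 1) (by omega),
      mul_left_comm (ttm _ _ _ _) _ (ttm _ _ _ _), zpow_add₀ (by norm_num), zpow_one, one_mul, mul_neg_one, mul_neg,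
      neg_mul, neg_neg]
    unfold ttm
    rw [← Complex.exp_add, ← Complex.exp_add]
    congr 2; push_cast; ring

theorem thI2 (x y z : ℂ) {τ : ℂ} (hτ : 0 < τ.im) :
    theta4 x τ * theta4 y τ * theta4 z τ * theta4 (x + y + z) τ
      + theta1 x τ * theta1 y τ * theta1 z τ * theta1 (x + y + z) τ
    = theta4 0 τ * theta4 (x + y) τ * theta4 (x + z) τ * theta4 (y + z) τ := by
  have e1 := t44 x y hτ
  have e2 := t44 (x + y + z) z hτ
  have e3 := t11 x y hτ
  have e4 := t11 (x + y + z) z hτ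
  have e5 := t44 (x + y) 0 hτ
  have e6 := t44 (x + z) (y + z) hτ
  rw [show x + y + z - z = x + y by ring] at e2 e4
  rw [sub_zero, add_zero] at e5
  rw [show x + z + (y + z) = x + y + z + z by ring, show x + z - (y + z) = x - y by ring] at e6
  linear_combination (theta4 z τ * theta4 (x + y + z) τ) * e1 + (thA (x + y) τ * thA (x - y) τ - thB (x + y) τ * thB (x - y) τ) * e2
    + (theta1 z τ * theta1 (x + y + z) τ) * e3 + (thA (x + y) τ * thB (x - y) τ - thB (x + y) τ * thA (x - y) τ) * e4
    - theta4 (x + z) τ * theta4 (y + z) τ * e5 - (thA (x + y) τ * thA (x + y) τ - thB (x + y) τ * thB (x + y) τ) * e6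

theorem thI1 (x y z : ℂ) {τ : ℂ} (hτ : 0 < τ.im) :
    theta4 x τ * theta1 y τ * theta1 z τ * theta4 (x + y + z) τ
      + theta1 x τ * theta4 y τ * theta4 z τ * theta1 (x + y + z) τ
    = theta4 0 τ * theta4 (y + z) τ * theta1 (x + y) τ * theta1 (x + z) τ := by
  have e1 := t11 y z hτ
  have e2 := t44 (x + y + z) x hτ
  have e3 := t44 y z hτ
  have e4 := t11 (x + y + z) x hτ
  have e5 := t44 (y + z) 0 hτ
  have e6 := t11 (x + y) (x + z) hτ
  rw [show x + y + z - x = y + z by ring] at e2 e4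
  rw [sub_zero, add_zero] at e5
  rw [show x + y + (x + z) = x + y + z + x by ring, show x + y - (x + z) = y - z by ring] at e6
  linear_combination (theta4 x τ * theta4 (x + y + z) τ) * e1 + (thA (y + z) τ * thB (y - z) τ - thB (y + z) τ * thA (y - z) τ) * e2
    + (theta1 x τ * theta1 (x + y + z) τ) * e3 + (thA (y + z) τ * thA (y - z) τ - thB (y + z) τ * thB (y - z) τ) * e4
    - theta1 (x + z) τ * theta1 (x + y) τ * e5 - (thA (y + z) τ * thA (y + z) τ - thB (y + z) τ * thB (y + z) τ) * e6

theorem theta1_neg (z τ : ℂ) : theta1 (-z) τ = - theta1 z τ := by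
  rw [theta1_ttm, theta1_ttm, ← tsum_neg, ← Equiv.tsum_eq ((Equiv.neg ℤ).trans (Equiv.addRight (-1)))]
  refine tsum_congr fun n => ?_
  have : ((Equiv.neg ℤ).trans (Equiv.addRight (-1))) n = -n + -1 := rfl
  rw [this, zpow_add₀ (by norm_num), neg_one_zpow_congr (-n) n (by omega)]
  have h : ttm (1/2) (-z) τ (-n + -1) = ttm (1/2) z τ n := by
    unfold ttm; congr 1; push_cast; ring
  rw [h]; norm_num

theorem theta4_neg (z τ : ℂ) : theta4 (-z) τ = theta4 z τ := by
  rw [theta4_ttm, theta4_ttm, ← Equiv.tsum_eq (Equiv.neg ℤ)]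
  refine tsum_congr fun n => ?_
  rw [Equiv.neg_apply, neg_one_zpow_congr (-n) n (by omega)]
  have h : ttm 0 (-z) τ (-n) = ttm 0 z τ n := by
    unfold ttm; congr 1; push_cast; ring
  rw [h]


/-- Kronecker product over a noncommutative ring. -/
def kr {A : Type*} [Mul A] (X Y : Matrix (Fin 2) (Fin 2) A) :
    Matrix (Fin 2 × Fin 2) (Fin 2 × Fin 2) A :=
  Matrix.of fun p q => X p.1 q.1 * Y p.2 q.2

/-- eight-vertex L -/
def L8 (a b c d : ℂ) : Matrix (Fin 2) (Fin 2) (Matrix (Fin 2) (Fin 2) ℂ) :=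
  !![!![a, 0; 0, b], !![0, d; c, 0]; !![0, c; d, 0], !![b, 0; 0, a]]

/-- eight-vertex R -/
def R8 (a b c d : ℂ) : Matrix (Fin 2 × Fin 2) (Fin 2 × Fin 2) ℂ :=
  Matrix.of fun p q =>
    if p = q then (if p.1 = p.2 then a else c)
    else if q = (p.2, p.1) ∧ p.1 ≠ p.2 then b
    else if p.1 = p.2 ∧ q.1 = q.2 then d
    else 0

theorem Lsite_eq (K K' η μ : ℂ) : Lsite K K' η μ =
    L8 (w4p3 K K' η μ) (w4m3 K K' η μ) (w1p2 K K' η μ) (w1m2 K K' η μ) := by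
  have hI : ∀ z : ℂ, Complex.I * z * Complex.I = -z := fun z => by
    linear_combination z * Complex.I_mul_I
  ext i j k l
  fin_cases i <;> fin_cases j <;> fin_cases k <;> fin_cases l <;>
    simp [Lsite, L8, σx, σy, σz, wc1, wc2, wc3, wc4, hI] <;> ring

theorem algM (z : ℂ) : algebraMap ℂ (Matrix (Fin 2) (Fin 2) ℂ) z = !![z, 0; 0, z] := by
  ext i j
  fin_cases i <;> fin_cases j <;> simp [Matrix.algebraMap_matrix_apply]

set_option maxHeartbeats 4000000 in
theorem site_ybe (a b c d a' b' c' d' a'' b'' c'' d'' : ℂ)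
    (e1 : a * c' * a'' + d * a' * d'' = b * c' * b'' + c * a' * c'')
    (e2 : a * b' * c'' + d * d' * b'' = b * a' * c'' + c * c' * b'')
    (e3 : c * b' * a'' + b * d' * d'' = c * a' * b'' + b * c' * c'')
    (e4 : a * d' * b'' + d * b' * c'' = b * d' * a'' + c * b' * d'')
    (e5 : a * a' * d'' + d * c' * a'' = b * b' * d'' + c * d' * a'')
    (e6 : d * a' * a'' + a * c' * d'' = d * b' * b'' + a * d' * c'') :
    (R8 a b c d).map (algebraMap ℂ (Matrix (Fin 2) (Fin 2) ℂ)) * kr (L8 a' b' c' d') (L8 a'' b'' c'' d'')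
      = kr (L8 a'' b'' c'' d'') (L8 a' b' c' d') * (R8 a b c d).map (algebraMap ℂ (Matrix (Fin 2) (Fin 2) ℂ)) := by
  ext ⟨p1, p2⟩ ⟨q1, q2⟩ i j
  fin_cases p1 <;> fin_cases p2 <;> fin_cases q1 <;> fin_cases q2 <;> fin_cases i <;> fin_cases j <;>
    simp [Matrix.mul_apply, kr, L8, R8, Fintype.sum_prod_type, Fin.sum_univ_two, algM] <;>
    first
    | done
    | ring1
    | linear_combination e1
    | linear_combination -e1
    | linear_combination e2
    | linear_combination -e2
    | linear_combination e3
    | linear_combination -e3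
    | linear_combination e4
    | linear_combination -e4
    | linear_combination e5
    | linear_combination -e5
    | linear_combination e6
    | linear_combination -e6

theorem hI1 (K K' x y z w : ℂ) (hτ : 0 < (Complex.I * K' / K).im) (hw : w = x + y + z) :
    ΘJ K K' x * HJ K K' y * HJ K K' z * ΘJ K K' w + HJ K K' x * ΘJ K K' y * ΘJ K K' z * HJ K K' w
     = ΘJ K K' 0 * ΘJ K K' (y + z) * HJ K K' (x + y) * HJ K K' (x + z) := by
  have h := thI1 ((Real.pi : ℂ) * x / (2 * K)) ((Real.pi : ℂ) * y / (2 * K)) ((Real.pi : ℂ) * z / (2 * K)) hτ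
  subst hw
  unfold HJ ΘJ
  simp only [mul_add, add_div, mul_zero, zero_div]
  exact h

theorem hI2 (K K' x y z w : ℂ) (hτ : 0 < (Complex.I * K' / K).im) (hw : w = x + y + z) :
    ΘJ K K' x * ΘJ K K' y * ΘJ K K' z * ΘJ K K' w + HJ K K' x * HJ K K' y * HJ K K' z * HJ K K' w
     = ΘJ K K' 0 * ΘJ K K' (x + y) * ΘJ K K' (x + z) * ΘJ K K' (y + z) := by
  have h := thI2 ((Real.pi : ℂ) * x / (2 * K)) ((Real.pi : ℂ) * y / (2 * K)) ((Real.pi : ℂ) * z / (2 * K)) hτ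
  subst hw
  unfold HJ ΘJ
  simp only [mul_add, add_div, mul_zero, zero_div]
  exact h

theorem HJ_neg (K K' x : ℂ) : HJ K K' (-x) = - HJ K K' x := by
  unfold HJ; rw [← theta1_neg]; congr 1; ring

theorem ΘJ_neg (K K' x : ℂ) : ΘJ K K' (-x) = ΘJ K K' x := by
  unfold ΘJ; rw [← theta4_neg]; congr 1; ring

section YB
variable (K K' e p q : ℂ) (hτ : 0 < (Complex.I * K' / K).im)

theorem fF2 (K K' e p q r d : ℂ) (hτ : 0 < (Complex.I * K' / K).im) (hr : r = p + q + e) (hd : d = q - p) :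
    ΘJ K K' p * ΘJ K K' (p + e) * ΘJ K K' q * ΘJ K K' (q + e) - HJ K K' p * HJ K K' (p + e) * HJ K K' q * HJ K K' (q + e)
    = ΘJ K K' 0 * ΘJ K K' e * ΘJ K K' d * ΘJ K K' r := by
  have h := hI2 K K' (-p) (p + e) q (q + e) hτ (by ring)
  rw [HJ_neg, ΘJ_neg, show -p + (p + e) = e by ring, show -p + q = d by rw [hd]; ring,
    show p + e + q = r by rw [hr]; ring] at h
  linear_combination h

theorem fF1 (K K' e p q r d : ℂ) (hτ : 0 < (Complex.I * K' / K).im) (hr : r = p + q + e) (hd : d = q - p) :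
    ΘJ K K' p * HJ K K' (p + e) * HJ K K' q * ΘJ K K' (q + e) - HJ K K' p * ΘJ K K' (p + e) * ΘJ K K' q * HJ K K' (q + e)
    = ΘJ K K' 0 * HJ K K' e * HJ K K' d * ΘJ K K' r := by
  have h := hI1 K K' (-p) (p + e) q (q + e) hτ (by ring)
  rw [HJ_neg, ΘJ_neg, show -p + (p + e) = e by ring, show -p + q = d by rw [hd]; ring,
    show p + e + q = r by rw [hr]; ring] at h
  linear_combination h

theorem fF3 (K K' e p q r d : ℂ) (hτ : 0 < (Complex.I * K' / K).im) (hr : r = p + q + e) (hd : d = q - p) :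
    ΘJ K K' p * HJ K K' (p + e) * ΘJ K K' q * HJ K K' (q + e) - HJ K K' p * ΘJ K K' (p + e) * HJ K K' q * ΘJ K K' (q + e)
    = ΘJ K K' 0 * HJ K K' e * ΘJ K K' d * HJ K K' r := by
  have h := hI1 K K' (p + e) (-p) q (q + e) hτ (by ring)
  rw [HJ_neg, ΘJ_neg, show p + e + -p = e by ring, show -p + q = d by rw [hd]; ring,
    show p + e + q = r by rw [hr]; ring] at h
  linear_combination h

theorem fF4 (K K' e p q r d : ℂ) (hτ : 0 < (Complex.I * K' / K).im) (hr : r = p + q + e) (hd : d = q - p) :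
    ΘJ K K' p * ΘJ K K' (p + e) * HJ K K' q * HJ K K' (q + e) - HJ K K' p * HJ K K' (p + e) * ΘJ K K' q * ΘJ K K' (q + e)
    = ΘJ K K' 0 * ΘJ K K' e * HJ K K' d * HJ K K' r := by
  have h := hI1 K K' q (-p) (p + e) (q + e) hτ (by ring)
  rw [HJ_neg, ΘJ_neg, show -p + (p + e) = e by ring, show q + -p = d by rw [hd]; ring,
    show q + (p + e) = r by rw [hr]; ring] at h
  linear_combination h
end YB

theorem Rc_eq (K K' η lam mu : ℂ) : Rc K K' η lam mu =
    R8 (aJ K K' η lam mu) (cJ K K' η lam mu) (bJ K K' η lam mu) (dJ K K' η lam mu) := rfl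

/-- RTT relation for a pair. -/
def RTT {A : Type*} [Ring A] [Algebra ℂ A] (R : Matrix (Fin 2 × Fin 2) (Fin 2 × Fin 2) ℂ)
    (X Y : Matrix (Fin 2) (Fin 2) A) : Prop :=
  R.map (algebraMap ℂ A) * kr X Y = kr Y X * R.map (algebraMap ℂ A)

theorem Lsite_RTT (K K' η lam mu : ℂ) (hτ : 0 < (Complex.I * K' / K).im) :
    RTT (Rc K K' η lam mu) (Lsite K K' η lam) (Lsite K K' η mu) := by
  unfold RTT
  rw [Rc_eq, Lsite_eq, Lsite_eq]
  obtain ⟨e, he⟩ : ∃ e, e = 2 * η := ⟨_, rfl⟩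
  obtain ⟨u, hu⟩ : ∃ u, u = lam - mu := ⟨_, rfl⟩
  obtain ⟨v, hv⟩ : ∃ v, v = mu - η := ⟨_, rfl⟩
  obtain ⟨w, hw⟩ : ∃ w, w = lam - η := ⟨_, rfl⟩
  have hv' : mu + η = v + e := by rw [hv, he]; ring
  have hw' : lam + η = w + e := by rw [hw, he]; ring
  have huv : w = u + v := by rw [hw, hu, hv]; ring
  unfold aJ bJ cJ dJ w4p3 w4m3 w1p2 w1m2
  rw [hv', hw', ← he, ← hu, ← hv, ← hw]
  apply site_ybe
  · linear_combination ΘJ K K' e * HJ K K' e * ΘJ K K' w * (ΘJ K K' e * ΘJ K K' (w + e) * fF3 K K' e u v (w + e) (v - u) hτ (by rw [huv]) rfl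
      - HJ K K' e * HJ K K' (w + e) * fF2 K K' e u v (w + e) (v - u) hτ (by rw [huv]) rfl)
  · linear_combination ΘJ K K' e * HJ K K' e * ΘJ K K' (v + e) * (ΘJ K K' e * ΘJ K K' v * fF1 K K' e u w (u + w + e) v hτ rfl (by rw [huv]; ring)
      - HJ K K' e * HJ K K' v * fF2 K K' e u w (u + w + e) v hτ rfl (by rw [huv]; ring))
  · linear_combination ΘJ K K' e * HJ K K' e * ΘJ K K' (u + e) * (ΘJ K K' e * ΘJ K K' u * fF1 K K' e v w (v + w + e) u hτ rfl (by rw [huv]; ring)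
      - HJ K K' e * HJ K K' u * fF2 K K' e v w (v + w + e) u hτ rfl (by rw [huv]; ring))
  · linear_combination ΘJ K K' e * HJ K K' e * HJ K K' w * (ΘJ K K' e * HJ K K' (w + e) * fF1 K K' e u v (w + e) (v - u) hτ (by rw [huv]) rfl
      - HJ K K' e * ΘJ K K' (w + e) * fF4 K K' e u v (w + e) (v - u) hτ (by rw [huv]) rfl)
  · linear_combination ΘJ K K' e * HJ K K' e * HJ K K' (v + e) * (ΘJ K K' e * HJ K K' v * fF3 K K' e u w (u + w + e) v hτ rfl (by rw [huv]; ring)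
      - HJ K K' e * ΘJ K K' v * fF4 K K' e u w (u + w + e) v hτ rfl (by rw [huv]; ring))
  · linear_combination ΘJ K K' e * HJ K K' e * HJ K K' (u + e) * (ΘJ K K' e * HJ K K' u * fF3 K K' e v w (v + w + e) u hτ rfl (by rw [huv]; ring)
      - HJ K K' e * ΘJ K K' u * fF4 K K' e v w (v + w + e) u hτ rfl (by rw [huv]; ring))

/-- tensor of vectors -/
def vk (p q : Fin 2 → ℂ) : Fin 2 × Fin 2 → ℂ := fun i => p i.1 * q i.2

def psv (K K' x : ℂ) : Fin 2 → ℂ := ![HJ K K' x, ΘJ K K' x]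
def phv (K K' x : ℂ) : Fin 2 → ℂ := ![ΘJ K K' x, -HJ K K' x]

def kap (K K' z : ℂ) : ℂ := ΘJ K K' 0 * HJ K K' z * ΘJ K K' z

section INT

theorem Gs (K K' η lam mu : ℂ) (hτ : 0 < (Complex.I * K' / K).im) (x y e' u' : ℂ)
  (hx : x = y + (lam - mu) + 2 * η) (hu : u' = y + (lam - mu)) (he : e' = y + 2 * η) :
   (ΘJ K K' y * HJ K K' (2 * η) * HJ K K' (lam - mu) * ΘJ K K' x + HJ K K' y * ΘJ K K' (2 * η) * ΘJ K K' (lam - mu) * HJ K K' x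
     = ΘJ K K' 0 * ΘJ K K' (lam - mu + 2 * η) * HJ K K' e' * HJ K K' u') ∧
   (ΘJ K K' (2 * η) * HJ K K' y * HJ K K' (lam - mu) * ΘJ K K' x + HJ K K' (2 * η) * ΘJ K K' y * ΘJ K K' (lam - mu) * HJ K K' x
     = ΘJ K K' 0 * ΘJ K K' u' * HJ K K' e' * HJ K K' (lam - mu + 2 * η)) ∧
   (ΘJ K K' (lam - mu) * HJ K K' y * HJ K K' (2 * η) * ΘJ K K' x + HJ K K' (lam - mu) * ΘJ K K' y * ΘJ K K' (2 * η) * HJ K K' x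
     = ΘJ K K' 0 * ΘJ K K' e' * HJ K K' u' * HJ K K' (lam - mu + 2 * η)) ∧
   (ΘJ K K' y * ΘJ K K' (2 * η) * ΘJ K K' (lam - mu) * ΘJ K K' x + HJ K K' y * HJ K K' (2 * η) * HJ K K' (lam - mu) * HJ K K' x
     = ΘJ K K' 0 * ΘJ K K' e' * ΘJ K K' u' * ΘJ K K' (lam - mu + 2 * η)) := by
  refine ⟨?_, ?_, ?_, ?_⟩
  · rw [hI1 K K' y (2 * η) (lam - mu) x hτ (by rw [hx]; ring), he, hu, add_comm (2 * η)]
  · rw [hI1 K K' (2 * η) y (lam - mu) x hτ (by rw [hx]; ring), he, hu, add_comm (2 * η), add_comm (2 * η)]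
  · rw [hI1 K K' (lam - mu) y (2 * η) x hτ (by rw [hx]; ring), he, hu, add_comm (lam - mu) y]
  · rw [hI2 K K' y (2 * η) (lam - mu) x hτ (by rw [hx]; ring), he, hu, add_comm (2 * η)]

theorem int_psi (K K' η lam mu : ℂ) (hτ : 0 < (Complex.I * K' / K).im) (x y e' u' : ℂ)
  (hx : x = y + (lam - mu) + 2 * η) (hu : u' = y + (lam - mu)) (he : e' = y + 2 * η) : Rc K K' η lam mu *ᵥ vk (psv K K' x) (psv K K' y) =
    kap K K' (lam - mu + 2 * η) • vk (psv K K' e') (psv K K' u') := by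
  obtain ⟨g1, g2, g3, g4⟩ := Gs K K' η lam mu hτ x y e' u' hx hu he
  ext ⟨i, j⟩
  fin_cases i <;> fin_cases j <;>
    simp [Matrix.mulVec, dotProduct, vk, psv, Rc_eq, R8, Fintype.sum_prod_type, kap, aJ, bJ, cJ, dJ]
  · linear_combination HJ K K' (lam - mu + 2 * η) * g1
  · linear_combination ΘJ K K' (lam - mu + 2 * η) * g2
  · linear_combination ΘJ K K' (lam - mu + 2 * η) * g3
  · linear_combination HJ K K' (lam - mu + 2 * η) * g4

theorem int_psi' (K K' η lam mu : ℂ) (hτ : 0 < (Complex.I * K' / K).im) (x y e' u' : ℂ)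
  (hx : x = y + (lam - mu) + 2 * η) (hu : u' = y + (lam - mu)) (he : e' = y + 2 * η) : Rc K K' η lam mu *ᵥ vk (psv K K' y) (psv K K' x) =
    kap K K' (lam - mu + 2 * η) • vk (psv K K' u') (psv K K' e') := by
  obtain ⟨g1, g2, g3, g4⟩ := Gs K K' η lam mu hτ x y e' u' hx hu he
  ext ⟨i, j⟩
  fin_cases i <;> fin_cases j <;>
    simp [Matrix.mulVec, dotProduct, vk, psv, Rc_eq, R8, Fintype.sum_prod_type, kap, aJ, bJ, cJ, dJ]
  · linear_combination HJ K K' (lam - mu + 2 * η) * g1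
  · linear_combination ΘJ K K' (lam - mu + 2 * η) * g3
  · linear_combination ΘJ K K' (lam - mu + 2 * η) * g2
  · linear_combination HJ K K' (lam - mu + 2 * η) * g4

theorem int_phi (K K' η lam mu : ℂ) (hτ : 0 < (Complex.I * K' / K).im) (x y e' u' : ℂ)
  (hx : x = y + (lam - mu) + 2 * η) (hu : u' = y + (lam - mu)) (he : e' = y + 2 * η) : vk (phv K K' x) (phv K K' y) ᵥ* Rc K K' η lam mu =
    kap K K' (lam - mu + 2 * η) • vk (phv K K' e') (phv K K' u') := by
  obtain ⟨g1, g2, g3, g4⟩ := Gs K K' η lam mu hτ x y e' u' hx hu he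
  ext ⟨i, j⟩
  fin_cases i <;> fin_cases j <;>
    simp [Matrix.vecMul, dotProduct, vk, phv, Rc_eq, R8, Fintype.sum_prod_type, kap, aJ, bJ, cJ, dJ]
  · linear_combination HJ K K' (lam - mu + 2 * η) * g4
  · linear_combination -ΘJ K K' (lam - mu + 2 * η) * g3
  · linear_combination -ΘJ K K' (lam - mu + 2 * η) * g2
  · linear_combination HJ K K' (lam - mu + 2 * η) * g1

theorem int_phi' (K K' η lam mu : ℂ) (hτ : 0 < (Complex.I * K' / K).im) (x y e' u' : ℂ)
  (hx : x = y + (lam - mu) + 2 * η) (hu : u' = y + (lam - mu)) (he : e' = y + 2 * η) : vk (phv K K' y) (phv K K' x) ᵥ* Rc K K' η lam mu =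
    kap K K' (lam - mu + 2 * η) • vk (phv K K' u') (phv K K' e') := by
  obtain ⟨g1, g2, g3, g4⟩ := Gs K K' η lam mu hτ x y e' u' hx hu he
  ext ⟨i, j⟩
  fin_cases i <;> fin_cases j <;>
    simp [Matrix.vecMul, dotProduct, vk, phv, Rc_eq, R8, Fintype.sum_prod_type, kap, aJ, bJ, cJ, dJ]
  · linear_combination HJ K K' (lam - mu + 2 * η) * g4
  · linear_combination -ΘJ K K' (lam - mu + 2 * η) * g2
  · linear_combination -ΘJ K K' (lam - mu + 2 * η) * g3
  · linear_combination HJ K K' (lam - mu + 2 * η) * g1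
end INT


section KR
variable {A : Type*} [Ring A] [Algebra ℂ A]

theorem kr_mul (X1 X2 Y1 Y2 : Matrix (Fin 2) (Fin 2) A)
    (h : ∀ i j k l, Commute (X2 i j) (Y1 k l)) :
    kr (X1 * X2) (Y1 * Y2) = kr X1 Y1 * kr X2 Y2 := by
  ext p q
  simp only [kr, Matrix.of_apply, Matrix.mul_apply, Fintype.sum_prod_type, Finset.sum_mul_sum]
  refine Finset.sum_congr rfl fun i _ => Finset.sum_congr rfl fun j _ => ?_
  have := (h i q.1 p.2 j).eq
  simp only [mul_assoc]
  rw [← mul_assoc (X2 i q.1), this, mul_assoc]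

theorem RTT_mul (R : Matrix (Fin 2 × Fin 2) (Fin 2 × Fin 2) ℂ) (X1 X2 Y1 Y2 : Matrix (Fin 2) (Fin 2) A)
    (h1 : RTT R X1 Y1) (h2 : RTT R X2 Y2)
    (h : ∀ i j k l, Commute (X2 i j) (Y1 k l)) (h' : ∀ i j k l, Commute (Y2 i j) (X1 k l)) :
    RTT R (X1 * X2) (Y1 * Y2) := by
  unfold RTT at *
  rw [kr_mul _ _ _ _ h, kr_mul _ _ _ _ h', ← mul_assoc, h1, mul_assoc, h2, mul_assoc]

theorem RTT_one (R : Matrix (Fin 2 × Fin 2) (Fin 2 × Fin 2) ℂ) :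
    RTT R (1 : Matrix (Fin 2) (Fin 2) A) 1 := by
  have : kr (1 : Matrix (Fin 2) (Fin 2) A) 1 = 1 := by
    ext ⟨a, b⟩ ⟨c, d⟩
    simp only [kr, Matrix.of_apply, Matrix.one_apply, Prod.ext_iff]
    by_cases h1 : a = c <;> by_cases h2 : b = d <;> simp [h1, h2]
  unfold RTT
  rw [this, mul_one, one_mul]

theorem RTT_map {B : Type*} [Ring B] [Algebra ℂ B] (f : A →ₐ[ℂ] B)
    (R : Matrix (Fin 2 × Fin 2) (Fin 2 × Fin 2) ℂ) (X Y : Matrix (Fin 2) (Fin 2) A)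
    (h : RTT R X Y) : RTT R (X.map f) (Y.map f) := by
  unfold RTT at *
  have hk : ∀ X Y : Matrix (Fin 2) (Fin 2) A, kr (X.map f) (Y.map f) = (kr X Y).map f := by
    intro X Y; ext p q; simp [kr]
  have hR : R.map (algebraMap ℂ B) = (R.map (algebraMap ℂ A)).map f := by
    ext p q; simp
  rw [hk, hk, hR]
  have := congrArg (fun M => M.map f) h
  simpa only [Matrix.map_mul] using this

/-- contraction -/
def ctr (p q : Fin 2 → ℂ) (T : Matrix (Fin 2) (Fin 2) A) : A :=
  ∑ a, ∑ b, (p a * q b) • T a b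

def ctr2 (p q : Fin 2 × Fin 2 → ℂ) (T : Matrix (Fin 2 × Fin 2) (Fin 2 × Fin 2) A) : A :=
  ∑ a, ∑ b, (p a * q b) • T a b

theorem ctr2_kr (p p' q q' : Fin 2 → ℂ) (X Y : Matrix (Fin 2) (Fin 2) A) :
    ctr2 (vk p p') (vk q q') (kr X Y) = ctr p q X * ctr p' q' Y := by
  simp only [ctr2, ctr, vk, kr, Matrix.of_apply, Fintype.sum_prod_type, Fin.sum_univ_two,
    add_mul, mul_add, smul_mul_smul_comm]
  have e : ∀ a b c d : ℂ, a * b * (c * d) = a * c * (b * d) := by intros; ring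
  simp only [e]
  abel

theorem ctr2_left (p q : Fin 2 × Fin 2 → ℂ) (R : Matrix (Fin 2 × Fin 2) (Fin 2 × Fin 2) ℂ)
    (T : Matrix (Fin 2 × Fin 2) (Fin 2 × Fin 2) A) :
    ctr2 p q (R.map (algebraMap ℂ A) * T) = ctr2 (p ᵥ* R) q T := by
  simp only [ctr2, Matrix.mul_apply, Matrix.vecMul, dotProduct, Matrix.map_apply,
    Finset.smul_sum, Finset.sum_mul, Finset.sum_smul, ← Algebra.smul_def, smul_smul]
  rw [Finset.sum_comm]
  conv_rhs => rw [Finset.sum_comm]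
  refine Finset.sum_congr rfl fun b _ => ?_
  rw [Finset.sum_comm]
  refine Finset.sum_congr rfl fun c _ => Finset.sum_congr rfl fun a _ => ?_
  congr 1; ring

theorem ctr2_right (p q : Fin 2 × Fin 2 → ℂ) (R : Matrix (Fin 2 × Fin 2) (Fin 2 × Fin 2) ℂ)
    (T : Matrix (Fin 2 × Fin 2) (Fin 2 × Fin 2) A) :
    ctr2 p q (T * R.map (algebraMap ℂ A)) = ctr2 p (R *ᵥ q) T := by
  simp only [ctr2, Matrix.mul_apply, Matrix.mulVec, dotProduct, Matrix.map_apply,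
    Finset.smul_sum, Finset.mul_sum, Finset.sum_smul, ← Algebra.commutes, ← Algebra.smul_def, smul_smul]
  refine Finset.sum_congr rfl fun a _ => ?_
  rw [Finset.sum_comm]
  refine Finset.sum_congr rfl fun c _ => Finset.sum_congr rfl fun b _ => ?_
  congr 1; ring

theorem ctr2_smul_left (c : ℂ) (p q : Fin 2 × Fin 2 → ℂ)
    (T : Matrix (Fin 2 × Fin 2) (Fin 2 × Fin 2) A) : ctr2 (c • p) q T = c • ctr2 p q T := by
  simp only [ctr2, Finset.smul_sum, smul_smul, Pi.smul_apply, smul_eq_mul, mul_assoc]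

theorem ctr2_smul_right (c : ℂ) (p q : Fin 2 × Fin 2 → ℂ)
    (T : Matrix (Fin 2 × Fin 2) (Fin 2 × Fin 2) A) : ctr2 p (c • q) T = c • ctr2 p q T := by
  simp only [ctr2, Finset.smul_sum, smul_smul, Pi.smul_apply, smul_eq_mul, mul_left_comm]

end KR

section EMB
variable {L : ℕ}

theorem embed_apply (n : Fin L) (A : Matrix (Fin 2) (Fin 2) ℂ) (f g : Conf L) :
    embed L n A f g = if g = Function.update f n (g n) then A (f n) (g n) else 0 := by
  unfold embed
  rw [Matrix.of_apply, Finset.prod_ite_zero, Finset.prod_const_one, mul_ite, mul_one, mul_zero]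
  congr 1
  apply propext
  constructor
  · intro h
    ext m
    by_cases hm : m = n
    · subst hm; simp
    · rw [Function.update_of_ne hm, h m (by simp [hm])]
  · intro h m hm
    rw [h, Function.update_of_ne (by simpa using hm)]

theorem embed_mul_apply (n : Fin L) (A : Matrix (Fin 2) (Fin 2) ℂ) (B : OpC L) (f g : Conf L) :
    (embed L n A * B) f g = ∑ i, A (f n) i * B (Function.update f n i) g := by
  rw [Matrix.mul_apply]
  simp only [embed_apply, ite_mul, zero_mul]
  rw [← Finset.sum_filter]
  symm
  refine Finset.sum_bij (fun i _ => Function.update f n i) ?_ ?_ ?_ ?_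
  · intro i _; simp
  · intro i _ j _ h
    have := congrFun h n
    simpa using this
  · intro h hh
    simp only [Finset.mem_filter, Finset.mem_univ, true_and] at hh
    exact ⟨h n, Finset.mem_univ _, hh.symm⟩
  · intro i _; simp

theorem embed_one (n : Fin L) : embed L n 1 = 1 := by
  ext f g
  rw [embed_apply]
  by_cases h : f = g
  · subst h; simp
  · rw [Matrix.one_apply_ne h]
    split_ifs with h1
    · rw [Matrix.one_apply, if_neg]
      intro h2
      apply h; rw [h1, ← h2]; simp
    · rfl

def embedA (n : Fin L) : Matrix (Fin 2) (Fin 2) ℂ →ₐ[ℂ] OpC L :=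
  AlgHom.ofLinearMap
    { toFun := embed L n
      map_add' := by intro A B; ext f g; simp [embed, add_mul]
      map_smul' := by intro c A; ext f g; simp [embed, mul_assoc] }
    (embed_one n)
    (by
      intro A B
      ext f g
      show embed L n (A * B) f g = (embed L n A * embed L n B) f g
      rw [embed_mul_apply]
      simp only [embed_apply, Function.update_idem, Function.update_self, Matrix.mul_apply]
      split_ifs with h
      · rfl
      · simp)

theorem embed_commute (n m : Fin L) (h : n ≠ m) (A B : Matrix (Fin 2) (Fin 2) ℂ) :
    Commute (embed L n A) (embed L m B) := by
  unfold Commute SemiconjBy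
  have key : ∀ (n m : Fin L), n ≠ m → ∀ (A B : Matrix (Fin 2) (Fin 2) ℂ) (C : OpC L) (f g : Conf L),
     (embed L n A * (embed L m B * C)) f g = ∑ i, ∑ j, A (f n) i * B (f m) j * C (Function.update (Function.update f n i) m j) g := by
    intro n m h A B C f g
    rw [embed_mul_apply]
    refine Finset.sum_congr rfl fun i _ => ?_
    rw [embed_mul_apply, Finset.mul_sum]
    refine Finset.sum_congr rfl fun j _ => ?_
    rw [Function.update_of_ne h.symm, mul_assoc]
  ext f g
  have k1 := key n m h A B 1 f g
  have k2 := key m n h.symm B A 1 f g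
  rw [mul_one] at k1 k2
  rw [k1, k2, Finset.sum_comm]
  refine Finset.sum_congr rfl fun i _ => Finset.sum_congr rfl fun j _ => ?_
  rw [Function.update_comm h, mul_comm (A _ _)]

def TL (K K' η μ : ℂ) (ns : List (Fin L)) : Matrix (Fin 2) (Fin 2) (OpC L) :=
  (ns.map fun n => Lop K K' η L n μ).prod

theorem TL_commute (K K' η μ : ℂ) (ns : List (Fin L)) (n : Fin L) (hn : n ∉ ns)
    (A : Matrix (Fin 2) (Fin 2) ℂ) : ∀ i j, Commute (TL K K' η μ ns i j) (embed L n A) := by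
  induction ns with
  | nil =>
    intro i j
    simp only [TL, List.map_nil, List.prod_nil, Matrix.one_apply]
    split_ifs
    · exact Commute.one_left _
    · exact Commute.zero_left _
  | cons m ns ih =>
    intro i j
    simp only [List.mem_cons, not_or] at hn
    have : TL K K' η μ (m :: ns) = Lop K K' η L m μ * TL K K' η μ ns := by simp [TL]
    rw [this, Matrix.mul_apply]
    refine Commute.sum_left _ _ _ fun k _ => ?_
    refine Commute.mul_left ?_ (ih hn.2 k j)
    exact embed_commute _ _ (Ne.symm hn.1) _ _

theorem TL_RTT (K K' η lam mu : ℂ) (hτ : 0 < (Complex.I * K' / K).im) (ns : List (Fin L))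
    (hns : ns.Nodup) : RTT (Rc K K' η lam mu) (TL K K' η lam ns) (TL K K' η mu ns) := by
  induction ns with
  | nil => simpa [TL] using RTT_one _
  | cons m ns ih =>
    have : ∀ μ, TL K K' η μ (m :: ns) = Lop K K' η L m μ * TL K K' η μ ns := by simp [TL]
    rw [this, this]
    rw [List.nodup_cons] at hns
    apply RTT_mul
    · exact RTT_map (embedA m) _ _ _ (Lsite_RTT K K' η lam mu hτ)
    · exact ih hns.2
    · intro i j k l; exact TL_commute _ _ _ _ _ _ hns.1 _ _ _
    · intro i j k l; exact TL_commute _ _ _ _ _ _ hns.1 _ _ _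

theorem Tm_RTT (K K' η lam mu : ℂ) (hτ : 0 < (Complex.I * K' / K).im) :
    RTT (Rc K K' η lam mu) (Tm K K' η L lam) (Tm K K' η L mu) := by
  have : ∀ μ, Tm K K' η L μ = TL K K' η μ (List.ofFn fun i : Fin L => i.rev) := by
    intro μ; simp [Tm, TL, List.map_ofFn, Function.comp_def]
  rw [this, this]
  apply TL_RTT _ _ _ _ _ hτ
  rw [List.nodup_ofFn]
  exact Fin.rev_injective

end EMB

/-- contracted monodromy -/
def Bt (K K' η : ℂ) (L : ℕ) (p q μ : ℂ) : OpC L := ctr (phv K K' p) (psv K K' q) (Tm K K' η L μ)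

theorem exB (K K' η : ℂ) (L : ℕ) (p q lam mu : ℂ) (hτ : 0 < (Complex.I * K' / K).im) :
    kap K K' (lam - mu + 2 * η) • (Bt K K' η L (p + lam) (q + 2 * η + lam) lam * Bt K K' η L (p + 2 * η + mu) (q + mu) mu)
   = kap K K' (lam - mu + 2 * η) • (Bt K K' η L (p + mu) (q + 2 * η + mu) mu * Bt K K' η L (p + 2 * η + lam) (q + lam) lam) := by
  have h := congrArg (ctr2 (vk (phv K K' (p + mu)) (phv K K' (p + 2 * η + lam)))
     (vk (psv K K' (q + 2 * η + lam)) (psv K K' (q + mu)))) (Tm_RTT (L := L) K K' η lam mu hτ)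
  rw [ctr2_left, ctr2_right, int_phi' K K' η lam mu hτ _ _ (p + 2 * η + mu) (p + lam) (by ring) (by ring) (by ring),
    int_psi K K' η lam mu hτ _ _ (q + 2 * η + mu) (q + lam) (by ring) (by ring) (by ring),
    ctr2_smul_left, ctr2_smul_right, ctr2_kr, ctr2_kr] at h
  exact h

theorem exC (K K' η : ℂ) (L : ℕ) (p q lam mu : ℂ) (hτ : 0 < (Complex.I * K' / K).im) :
    kap K K' (lam - mu + 2 * η) • (Bt K K' η L (p - lam) (q - lam) lam * Bt K K' η L (p - 2 * η - mu) (q + 2 * η - mu) mu)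
   = kap K K' (lam - mu + 2 * η) • (Bt K K' η L (p - mu) (q - mu) mu * Bt K K' η L (p - 2 * η - lam) (q + 2 * η - lam) lam) := by
  have h := congrArg (ctr2 (vk (phv K K' (p - mu)) (phv K K' (p - 2 * η - lam)))
     (vk (psv K K' (q - lam)) (psv K K' (q + 2 * η - mu)))) (Tm_RTT (L := L) K K' η lam mu hτ)
  rw [ctr2_left, ctr2_right, int_phi K K' η lam mu hτ _ _ (p - lam) (p - 2 * η - mu) (by ring) (by ring) (by ring),
    int_psi' K K' η lam mu hτ _ _ (q + 2 * η - lam) (q - mu) (by ring) (by ring) (by ring),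
    ctr2_smul_left, ctr2_smul_right, ctr2_kr, ctr2_kr] at h
  exact h

theorem sgn_ttm (c a z τ : ℂ) (n : ℤ) : c * (-1 : ℂ) ^ n * ttm a z τ n =
    (c * Complex.exp (-((Real.pi : ℂ) * Complex.I * a))) * ttm a (z + (Real.pi : ℂ) / 2) τ n := by
  have : ((-1 : ℂ)) ^ n = Complex.exp ((n : ℂ) * ((Real.pi : ℂ) * Complex.I)) := by
    rw [Complex.exp_int_mul, Complex.exp_pi_mul_I]
  rw [this]
  unfold ttm
  rw [mul_assoc c, mul_assoc c, ← Complex.exp_add, ← Complex.exp_add]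
  congr 2; ring

theorem sgn_tsum_diff (c a : ℂ) {τ : ℂ} (hτ : 0 < τ.im) :
    Differentiable ℂ (fun z => ∑' n : ℤ, c * (-1 : ℂ) ^ n * ttm a z τ n) := by
  have : (fun z => ∑' n : ℤ, c * (-1 : ℂ) ^ n * ttm a z τ n) = fun z =>
      (c * Complex.exp (-((Real.pi : ℂ) * Complex.I * a))) *
      (Complex.exp ((Real.pi : ℂ) * Complex.I * a ^ 2 * τ + 2 * a * Complex.I * (z + (Real.pi : ℂ) / 2)) *
       (fun w => jacobiTheta₂ w τ) ((z + (Real.pi : ℂ) / 2) / (Real.pi : ℂ) + a * τ)) := by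
    ext z
    simp only [sgn_ttm]
    simp only [ttm_eq, tsum_mul_left, jacobiTheta₂]
  rw [this]
  have hd : Differentiable ℂ (fun w => jacobiTheta₂ w τ) := fun w => differentiableAt_jacobiTheta₂_fst w hτ
  have hl : Differentiable ℂ (fun z : ℂ => (z + (Real.pi : ℂ) / 2) / (Real.pi : ℂ) + a * τ) := by fun_prop
  have := hd.comp hl
  have h2 : Differentiable ℂ (fun z : ℂ => Complex.exp ((Real.pi : ℂ) * Complex.I * a ^ 2 * τ + 2 * a * Complex.I * (z + (Real.pi : ℂ) / 2))) := by fun_prop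
  exact (h2.mul this).const_mul _

theorem HJ_diff (K K' : ℂ) (hτ : 0 < (Complex.I * K' / K).im) : Differentiable ℂ (HJ K K') := by
  have h := sgn_tsum_diff (-Complex.I) (1 / 2) hτ
  have hl : Differentiable ℂ (fun z : ℂ => (Real.pi : ℂ) * z / (2 * K)) := by fun_prop
  have h2 := h.comp hl
  have e : HJ K K' = (fun z => ∑' n : ℤ, -Complex.I * (-1 : ℂ) ^ n * ttm (1/2) z (Complex.I * K' / K) n) ∘ (fun z : ℂ => (Real.pi : ℂ) * z / (2 * K)) := by
    ext z; simp only [HJ, theta1_ttm, Function.comp]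
  rw [e]; exact h2

theorem ΘJ_diff (K K' : ℂ) (hτ : 0 < (Complex.I * K' / K).im) : Differentiable ℂ (ΘJ K K') := by
  have h := sgn_tsum_diff 1 0 hτ
  have hl : Differentiable ℂ (fun z : ℂ => (Real.pi : ℂ) * z / (2 * K)) := by fun_prop
  have h2 := h.comp hl
  have e : ΘJ K K' = (fun z => ∑' n : ℤ, 1 * (-1 : ℂ) ^ n * ttm 0 z (Complex.I * K' / K) n) ∘ (fun z : ℂ => (Real.pi : ℂ) * z / (2 * K)) := by
    ext z; simp only [ΘJ, theta4_ttm, Function.comp]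
  rw [e]; exact h2

theorem entire_mul (f g : ℂ → ℂ) (hf : Differentiable ℂ f) (hg : Differentiable ℂ g)
    (h : ∀ z, f z * g z = 0) : (∀ z, f z = 0) ∨ (∀ z, g z = 0) := by
  have hf' : AnalyticOnNhd ℂ f Set.univ := fun z _ => hf.analyticAt z
  have hg' : AnalyticOnNhd ℂ g Set.univ := fun z _ => hg.analyticAt z
  rcases hf'.eq_zero_or_eq_zero_of_mul_eq_zero hg' (fun z _ => h z) isPreconnected_univ with h | h
  · exact Or.inl fun z => h z trivial
  · exact Or.inr fun z => h z trivial

def DJ (K K' x y : ℂ) : ℂ := HJ K K' x * ΘJ K K' y - ΘJ K K' x * HJ K K' y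

theorem DJ_fact (K K' x y : ℂ) (hτ : 0 < (Complex.I * K' / K).im) : DJ K K' x y =
    thF ((Real.pi : ℂ) * (x + y) / (2 * K)) (Complex.I * K' / K) *
    thf ((Real.pi : ℂ) * (x - y) / (2 * K)) (Complex.I * K' / K) := by
  have h := tdet ((Real.pi : ℂ) * x / (2 * K)) ((Real.pi : ℂ) * y / (2 * K)) hτ
  rw [mul_add, add_div, mul_sub, sub_div, ← h]
  rfl

theorem HJ_zero (K K' : ℂ) : HJ K K' 0 = 0 := by
  have h := HJ_neg K K' 0
  rw [neg_zero] at h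
  linear_combination h / 2

theorem degen (K K' : ℂ) (hτ : 0 < (Complex.I * K' / K).im) :
    (∃ z, kap K K' z ≠ 0) ∨ ∀ x y, DJ K K' x y = 0 := by
  by_cases hk : ∃ z, kap K K' z ≠ 0
  · exact Or.inl hk
  right
  push Not at hk
  have hH := HJ_diff K K' hτ
  have hT := ΘJ_diff K K' hτ
  have h1 : ΘJ K K' 0 = 0 ∨ ∀ z, HJ K K' z * ΘJ K K' z = 0 := by
    by_cases h0 : ΘJ K K' 0 = 0
    · exact Or.inl h0
    · right; intro z
      have := hk z
      unfold kap at this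
      rw [mul_assoc] at this
      exact (mul_eq_zero.mp this).resolve_left h0
  rcases h1 with h0 | h1
  · intro x0 y0
    have hd0 : ∀ x, DJ K K' x 0 = 0 := by intro x; simp [DJ, h0, HJ_zero]
    have hp : ∀ x y x' y', x + y = x' - y' → DJ K K' x y * DJ K K' x' y' = 0 := by
      intro x y x' y' he
      have := hd0 (x + y)
      rw [DJ_fact _ _ _ _ hτ, add_zero, sub_zero] at this
      rw [DJ_fact _ _ _ _ hτ, DJ_fact _ _ _ _ hτ, ← he]
      linear_combination this * thf ((Real.pi : ℂ) * (x - y) / (2 * K)) (Complex.I * K' / K) *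
        thF ((Real.pi : ℂ) * (x' + y') / (2 * K)) (Complex.I * K' / K)
    have hf : Differentiable ℂ (fun z => DJ K K' (x0 + z) (y0 + z)) := by
      unfold DJ; fun_prop
    have hg : Differentiable ℂ (fun z => DJ K K' (x0 + (z + y0)) (y0 - (z + y0))) := by
      unfold DJ; fun_prop
    rcases entire_mul _ _ hf hg (fun z => hp _ _ _ _ (by ring)) with h | h
    · simpa using h 0
    · simpa using h (-y0)
  · rcases entire_mul _ _ hH hT h1 with h | h <;> intro x y <;> simp [DJ, h]

/-- Entrywise holomorphic. -/
def ED {L : ℕ} (X : ℂ → OpC L) : Prop := ∀ f g, Differentiable ℂ fun μ => X μ f g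

theorem ED_mul {L : ℕ} {X Y : ℂ → OpC L} (hX : ED X) (hY : ED Y) : ED fun μ => X μ * Y μ := by
  intro f g
  simp only [Matrix.mul_apply]
  exact Differentiable.fun_sum fun i _ => (hX f i).mul (hY i g)

theorem ED_sum {L : ℕ} {ι : Type*} (s : Finset ι) {X : ι → ℂ → OpC L} (hX : ∀ i, ED (X i)) :
    ED fun μ => ∑ i ∈ s, X i μ := by
  intro f g
  simp only [Matrix.sum_apply]
  exact Differentiable.fun_sum fun i _ => (hX i f g)

theorem ED_smul {L : ℕ} {X : ℂ → OpC L} {c : ℂ → ℂ} (hc : Differentiable ℂ c) (hX : ED X) :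
    ED fun μ => c μ • X μ := by
  intro f g
  simp only [Matrix.smul_apply, smul_eq_mul]
  exact hc.mul (hX f g)

theorem Lsite_diff (K K' η : ℂ) (hτ : 0 < (Complex.I * K' / K).im) (i j k l : Fin 2) :
    Differentiable ℂ fun μ => Lsite K K' η μ i j k l := by
  have hH := HJ_diff K K' hτ
  have hT := ΘJ_diff K K' hτ
  have h1 : Differentiable ℂ (wc1 K K' η) := by unfold wc1 w1p2 w1m2; fun_prop
  have h2 : Differentiable ℂ (wc2 K K' η) := by unfold wc2 w1p2 w1m2; fun_prop
  have h3 : Differentiable ℂ (wc3 K K' η) := by unfold wc3 w4p3 w4m3; fun_prop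
  have h4 : Differentiable ℂ (wc4 K K' η) := by unfold wc4 w4p3 w4m3; fun_prop
  fin_cases i <;> fin_cases j <;> simp [Lsite] <;> fun_prop

theorem Lop_ED (K K' η : ℂ) (hτ : 0 < (Complex.I * K' / K).im) {L : ℕ} (n : Fin L) (i j : Fin 2) :
    ED fun μ => Lop K K' η L n μ i j := by
  intro f g
  simp only [Lop, Matrix.map_apply, embed, Matrix.of_apply]
  exact (Lsite_diff K K' η hτ i j _ _).mul_const _

theorem Tm_ED (K K' η : ℂ) (hτ : 0 < (Complex.I * K' / K).im) (L : ℕ) (i j : Fin 2) :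
    ED fun μ => Tm K K' η L μ i j := by
  have : ∀ μ, Tm K K' η L μ = TL K K' η μ (List.ofFn fun i : Fin L => i.rev) := by
    intro μ; simp [Tm, TL, List.map_ofFn, Function.comp_def]
  simp only [this]
  generalize (List.ofFn fun i : Fin L => i.rev) = ns
  induction ns generalizing i j with
  | nil =>
    intro f g
    simp only [TL, List.map_nil, List.prod_nil]
    exact differentiable_const _
  | cons m ns ih =>
    have : ∀ μ, TL K K' η μ (m :: ns) = Lop K K' η L m μ * TL K K' η μ ns := by simp [TL]
    simp only [this, Matrix.mul_apply]
    exact ED_sum _ fun k => ED_mul (Lop_ED K K' η hτ m i k) (ih k j)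

theorem Bt_ED (K K' η : ℂ) (hτ : 0 < (Complex.I * K' / K).im) (L : ℕ) (p q : ℂ → ℂ)
    (hp : Differentiable ℂ p) (hq : Differentiable ℂ q) : ED fun μ => Bt K K' η L (p μ) (q μ) μ := by
  have hH := HJ_diff K K' hτ
  have hT := ΘJ_diff K K' hτ
  unfold Bt ctr
  refine ED_sum _ fun a => ED_sum _ fun b => ED_smul ?_ (Tm_ED K K' η hτ L a b)
  fin_cases a <;> fin_cases b <;> simp [phv, psv] <;> fun_prop

theorem Bt_ED' (K K' η : ℂ) (hτ : 0 < (Complex.I * K' / K).im) (L : ℕ) (p q r : ℂ) :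
    ED fun _ => Bt K K' η L p q r := fun _ _ => differentiable_const _

theorem cancel_kap (K K' : ℂ) (hτ : 0 < (Complex.I * K' / K).im) {L : ℕ} (c : ℂ)
    (hk : ∃ z, kap K K' z ≠ 0) (X Y : ℂ → OpC L) (hX : ED X) (hY : ED Y)
    (h : ∀ z, kap K K' (z + c) • X z = kap K K' (z + c) • Y z) (z : ℂ) : X z = Y z := by
  have hH := HJ_diff K K' hτ
  have hT := ΘJ_diff K K' hτ
  ext f g
  have hd : Differentiable ℂ fun z => kap K K' (z + c) := by unfold kap; fun_prop
  rcases entire_mul _ _ hd ((hX f g).sub (hY f g)) (fun z => by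
    have := congrFun (congrFun (h z) f) g
    simp only [Matrix.smul_apply, smul_eq_mul] at this
    simp only [Pi.sub_apply]
    linear_combination this) with h | h
  · obtain ⟨w, hw⟩ := hk
    exact absurd (by simpa using h (w - c)) hw
  · have := h z
    simp only [Pi.sub_apply] at this
    linear_combination this

theorem exB' (K K' η : ℂ) (L : ℕ) (p q lam mu : ℂ) (hτ : 0 < (Complex.I * K' / K).im)
    (hk : ∃ z, kap K K' z ≠ 0) :
    Bt K K' η L (p + lam) (q + 2 * η + lam) lam * Bt K K' η L (p + 2 * η + mu) (q + mu) mu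
   = Bt K K' η L (p + mu) (q + 2 * η + mu) mu * Bt K K' η L (p + 2 * η + lam) (q + lam) lam := by
  refine cancel_kap K K' hτ (2 * η - mu) hk
    (fun lam => Bt K K' η L (p + lam) (q + 2 * η + lam) lam * Bt K K' η L (p + 2 * η + mu) (q + mu) mu)
    (fun lam => Bt K K' η L (p + mu) (q + 2 * η + mu) mu * Bt K K' η L (p + 2 * η + lam) (q + lam) lam)
    (ED_mul (Bt_ED K K' η hτ L _ _ (by fun_prop) (by fun_prop)) (Bt_ED' K K' η hτ L _ _ _))
    (ED_mul (Bt_ED' K K' η hτ L _ _ _) (Bt_ED K K' η hτ L _ _ (by fun_prop) (by fun_prop)))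
    (fun z => ?_) lam
  have := exB K K' η L p q z mu hτ
  rwa [show z - mu + 2 * η = z + (2 * η - mu) by ring] at this

theorem exC' (K K' η : ℂ) (L : ℕ) (p q lam mu : ℂ) (hτ : 0 < (Complex.I * K' / K).im)
    (hk : ∃ z, kap K K' z ≠ 0) :
    Bt K K' η L (p - lam) (q - lam) lam * Bt K K' η L (p - 2 * η - mu) (q + 2 * η - mu) mu
   = Bt K K' η L (p - mu) (q - mu) mu * Bt K K' η L (p - 2 * η - lam) (q + 2 * η - lam) lam := by
  refine cancel_kap K K' hτ (2 * η - mu) hk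
    (fun lam => Bt K K' η L (p - lam) (q - lam) lam * Bt K K' η L (p - 2 * η - mu) (q + 2 * η - mu) mu)
    (fun lam => Bt K K' η L (p - mu) (q - mu) mu * Bt K K' η L (p - 2 * η - lam) (q + 2 * η - lam) lam)
    (ED_mul (Bt_ED K K' η hτ L _ _ (by fun_prop) (by fun_prop)) (Bt_ED' K K' η hτ L _ _ _))
    (ED_mul (Bt_ED' K K' η hτ L _ _ _) (Bt_ED K K' η hτ L _ _ (by fun_prop) (by fun_prop)))
    (fun z => ?_) lam
  have := exC K K' η L p q z mu hτ
  rwa [show z - mu + 2 * η = z + (2 * η - mu) by ring] at this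

theorem Mg_det (K K' η s t : ℂ) (k : ℤ) (μ : ℂ) : (Mg K K' η s t k μ).det =
    (gJ K K' (τJ K η s t k))⁻¹ * DJ K K' (s + 2 * (k : ℂ) * η - μ) (t + 2 * (k : ℂ) * η + μ) := by
  unfold Mg DJ
  rw [Matrix.det_fin_two_of]
  ring

def duJ (K K' η s t : ℂ) (k : ℤ) : ℂ := (gJ K K' (τJ K η s t k))⁻¹ *
  thF ((Real.pi : ℂ) * (s + t + 4 * (k : ℂ) * η) / (2 * K)) (Complex.I * K' / K)
def dvJ (K K' s t μ : ℂ) : ℂ :=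
  thf ((Real.pi : ℂ) * (s - t - 2 * μ) / (2 * K)) (Complex.I * K' / K)

theorem Mg_det' (K K' η s t : ℂ) (k : ℤ) (μ : ℂ) (hτ : 0 < (Complex.I * K' / K).im) :
    (Mg K K' η s t k μ).det = duJ K K' η s t k * dvJ K K' s t μ := by
  rw [Mg_det, DJ_fact _ _ _ _ hτ, duJ, dvJ, mul_assoc (gJ K K' (τJ K η s t k))⁻¹,
    show s + 2 * (k : ℂ) * η - μ + (t + 2 * (k : ℂ) * η + μ) = s + t + 4 * (k : ℂ) * η by ring,
    show s + 2 * (k : ℂ) * η - μ - (t + 2 * (k : ℂ) * η + μ) = s - t - 2 * μ by ring]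

theorem Tg_apply (K K' η s t : ℂ) (L : ℕ) (k l : ℤ) (μ : ℂ) (i j : Fin 2) :
    Tg K K' η s t L k l μ i j =
      ctr (fun a => (Mg K K' η s t k μ)⁻¹ i a) (fun b => Mg K K' η s t l μ b j) (Tm K K' η L μ) := by
  simp only [Tg, toOp, ctr, Matrix.mul_apply, Matrix.map_apply, Finset.sum_mul, smul_mul_assoc,
    mul_smul_comm, one_mul, mul_one, smul_smul]
  conv_rhs => rw [Finset.sum_comm]
  refine Finset.sum_congr rfl fun a _ => ?_
  rw [Finset.smul_sum]
  refine Finset.sum_congr rfl fun b _ => ?_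
  rw [smul_smul, mul_comm]

theorem ctr_smul {A : Type*} [Ring A] [Algebra ℂ A] (c d : ℂ) (p q : Fin 2 → ℂ)
    (T : Matrix (Fin 2) (Fin 2) A) :
    ctr (c • p) (d • q) T = (c * d) • ctr p q T := by
  simp only [ctr, Finset.smul_sum, smul_smul, Pi.smul_apply, smul_eq_mul]
  refine Finset.sum_congr rfl fun a _ => Finset.sum_congr rfl fun b _ => ?_
  congr 1; ring

theorem Bg_eq (K K' η s t : ℂ) (L : ℕ) (k l : ℤ) (μ : ℂ) :
    Bg K K' η s t L k l μ = (((Mg K K' η s t k μ).det)⁻¹ * (gJ K K' (τJ K η s t k))⁻¹ * (gJ K K' (τJ K η s t l))⁻¹) •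
      Bt K K' η L (t + 2 * (k : ℂ) * η + μ) (t + 2 * (l : ℂ) * η + μ) μ := by
  unfold Bg Bt
  rw [Tg_apply, ← ctr_smul]
  congr 1
  · ext a
    rw [Matrix.inv_def, Ring.inverse_eq_inv', Matrix.adjugate_fin_two]
    fin_cases a <;> simp [Mg, phv] <;> ring
  · ext b
    fin_cases b <;> simp [Mg, psv]

theorem Cg_eq (K K' η s t : ℂ) (L : ℕ) (k l : ℤ) (μ : ℂ) :
    Cg K K' η s t L k l μ = (-((Mg K K' η s t k μ).det)⁻¹ * 1) •
      Bt K K' η L (s + 2 * (k : ℂ) * η - μ) (s + 2 * (l : ℂ) * η - μ) μ := by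
  unfold Cg Bt
  rw [Tg_apply, ← ctr_smul]
  congr 1
  · ext a
    rw [Matrix.inv_def, Ring.inverse_eq_inv', Matrix.adjugate_fin_two]
    fin_cases a <;> simp [Mg, phv]
  · ext b
    fin_cases b <;> simp [Mg, psv]

theorem Bg_ex (K K' η s t : ℂ) (L : ℕ) (k l k' l' : ℤ) (hk' : k' = k + 1) (hl' : l' = l - 1) (lam mu : ℂ)
    (hτ : 0 < (Complex.I * K' / K).im) :
    Bg K K' η s t L k l lam * Bg K K' η s t L k' l' mu =
    Bg K K' η s t L k l mu * Bg K K' η s t L k' l' lam := by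
  rcases degen K K' hτ with hk | hD
  · subst hk' hl'
    have h := exB' K K' η L (t + 2 * (k : ℂ) * η) (t + 2 * ((l - 1 : ℤ) : ℂ) * η) lam mu hτ hk
    rw [show t + 2 * (k : ℂ) * η + 2 * η = t + 2 * ((k + 1 : ℤ) : ℂ) * η by push_cast; ring,
      show t + 2 * ((l - 1 : ℤ) : ℂ) * η + 2 * η = t + 2 * (l : ℂ) * η by push_cast; ring] at h
    simp only [Bg_eq, Mg_det' _ _ _ _ _ _ _ hτ, smul_mul_smul_comm]
    rw [h]
    congr 1
    simp only [mul_inv]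
    ring
  · simp only [Bg_eq, Mg_det, hD, mul_zero, _root_.inv_zero, zero_mul, zero_smul]

theorem Cg_ex (K K' η s t : ℂ) (L : ℕ) (k l k' l' : ℤ) (hk' : k' = k - 1) (hl' : l' = l + 1) (lam mu : ℂ)
    (hτ : 0 < (Complex.I * K' / K).im) :
    Cg K K' η s t L k l lam * Cg K K' η s t L k' l' mu =
    Cg K K' η s t L k l mu * Cg K K' η s t L k' l' lam := by
  rcases degen K K' hτ with hk | hD
  · subst hk' hl'
    have h := exC' K K' η L (s + 2 * (k : ℂ) * η) (s + 2 * (l : ℂ) * η) lam mu hτ hk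
    rw [show s + 2 * (k : ℂ) * η - 2 * η = s + 2 * ((k - 1 : ℤ) : ℂ) * η by push_cast; ring,
      show s + 2 * (l : ℂ) * η + 2 * η = s + 2 * ((l + 1 : ℤ) : ℂ) * η by push_cast; ring] at h
    simp only [Cg_eq, Mg_det' _ _ _ _ _ _ _ hτ, smul_mul_smul_comm]
    rw [h]
    congr 1
    simp only [mul_inv]
    ring
  · simp only [Cg_eq, Mg_det, hD, mul_zero, _root_.inv_zero, neg_zero, zero_mul, zero_smul]

/-- ordered product with running index -/
def oprod {M : Type*} [Monoid M] (F : ℕ → ℂ → M) : ℕ → List ℂ → M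
  | _, [] => 1
  | j, a :: as => F j a * oprod F (j + 1) as

theorem oprod_perm {M : Type*} [Monoid M] (F : ℕ → ℂ → M)
    (h : ∀ j a b, F j a * F (j + 1) b = F j b * F (j + 1) a) {as bs : List ℂ} (hp : as.Perm bs) :
    ∀ j, oprod F j as = oprod F j bs := by
  induction hp with
  | nil => intro j; rfl
  | cons x _ ih => intro j; simp only [oprod, ih]
  | swap x y l => intro j; simp only [oprod]; rw [← mul_assoc, h, mul_assoc]
  | trans _ _ ih1 ih2 => intro j; rw [ih1, ih2]

theorem oprod_ofFn {M : Type*} [Monoid M] (F : ℕ → ℂ → M) {n : ℕ} (lam : Fin n → ℂ) (i : ℕ) :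
    (List.ofFn fun j : Fin n => F (i + (j : ℕ)) (lam j)).prod = oprod F i (List.ofFn lam) := by
  induction n generalizing i with
  | zero => simp [oprod]
  | succ n ih =>
    rw [List.ofFn_succ, List.ofFn_succ, List.prod_cons, oprod, ← ih]
    simp only [Fin.val_zero, add_zero, Fin.val_succ]
    congr 4
    ext j
    rw [show i + ((j : ℕ) + 1) = i + 1 + (j : ℕ) by omega]

theorem oprod_sym {M : Type*} [Monoid M] (F : ℕ → ℂ → M)
    (h : ∀ j a b, F j a * F (j + 1) b = F j b * F (j + 1) a) {n : ℕ} (lam : Fin n → ℂ)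
    (σ : Equiv.Perm (Fin n)) :
    (List.ofFn fun j : Fin n => F (j : ℕ) (lam (σ j))).prod = (List.ofFn fun j : Fin n => F (j : ℕ) (lam j)).prod := by
  have h1 := oprod_ofFn F (lam ∘ σ) 0
  have h2 := oprod_ofFn F lam 0
  simp only [zero_add, Function.comp] at h1 h2
  rw [h1, h2]
  exact oprod_perm F h (Equiv.Perm.ofFn_comp_perm σ lam) 0

theorem psiB_sym (K K' η s t : ℂ) (hτ : 0 < (Complex.I * K' / K).im) (L N n : ℕ) (l : ℤ)
    (lam : Fin n → ℂ) (σ : Equiv.Perm (Fin n)) :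
    psiB K K' η s t L N n l (lam ∘ σ) = psiB K K' η s t L N n l lam := by
  have hF : ∀ (j : ℕ) (a b : ℂ), Bg K K' η s t L (l + (N : ℤ) - (n : ℤ) + 1 + (j : ℕ))
      (l - (N : ℤ) + (n : ℤ) - 1 - (j : ℕ)) a * Bg K K' η s t L (l + (N : ℤ) - (n : ℤ) + 1 + ((j + 1 : ℕ) : ℤ))
      (l - (N : ℤ) + (n : ℤ) - 1 - ((j + 1 : ℕ) : ℤ)) b = Bg K K' η s t L (l + (N : ℤ) - (n : ℤ) + 1 + (j : ℕ))
      (l - (N : ℤ) + (n : ℤ) - 1 - (j : ℕ)) b * Bg K K' η s t L (l + (N : ℤ) - (n : ℤ) + 1 + ((j + 1 : ℕ) : ℤ))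
      (l - (N : ℤ) + (n : ℤ) - 1 - ((j + 1 : ℕ) : ℤ)) a := by
    intro j a b
    apply Bg_ex
    · push_cast; ring
    · push_cast; ring
    · exact hτ
  have h := oprod_sym (fun (j : ℕ) a => Bg K K' η s t L (l + (N : ℤ) - (n : ℤ) + 1 + (j : ℕ))
    (l - (N : ℤ) + (n : ℤ) - 1 - (j : ℕ)) a) hF lam σ
  unfold psiB
  simp only [Function.comp_apply]
  rw [h]

theorem psiC_sym (K K' η s t : ℂ) (hτ : 0 < (Complex.I * K' / K).im) (L N n : ℕ) (l : ℤ)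
    (lam : Fin n → ℂ) (σ : Equiv.Perm (Fin n)) :
    psiC K K' η s t L N n l (lam ∘ σ) = psiC K K' η s t L N n l lam := by
  have hF : ∀ (j : ℕ) (a b : ℂ), Cg K K' η s t L (l + (N : ℤ) - 1 - (j : ℕ))
      (l - (N : ℤ) + 1 + (j : ℕ)) a * Cg K K' η s t L (l + (N : ℤ) - 1 - ((j + 1 : ℕ) : ℤ))
      (l - (N : ℤ) + 1 + ((j + 1 : ℕ) : ℤ)) b = Cg K K' η s t L (l + (N : ℤ) - 1 - (j : ℕ))
      (l - (N : ℤ) + 1 + (j : ℕ)) b * Cg K K' η s t L (l + (N : ℤ) - 1 - ((j + 1 : ℕ) : ℤ))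
      (l - (N : ℤ) + 1 + ((j + 1 : ℕ) : ℤ)) a := by
    intro j a b
    apply Cg_ex
    · push_cast; ring
    · push_cast; ring
    · exact hτ
  have h := fun (σ : Equiv.Perm (Fin n)) => oprod_sym (fun (j : ℕ) a => Cg K K' η s t L (l + (N : ℤ) - 1 - (j : ℕ))
    (l - (N : ℤ) + 1 + (j : ℕ)) a) hF lam σ
  have h1 := h (Fin.revPerm.trans σ)
  have h2 := h Fin.revPerm
  simp only [Equiv.trans_apply, Fin.revPerm_apply] at h1 h2
  unfold psiC
  simp only [Function.comp_apply]
  rw [h1, h2]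

theorem MnS_sym (K K' η s t : ℂ) (hτ : 0 < (Complex.I * K' / K).im)
    (Q L N n : ℕ) (lam : Fin n → ℂ) (σ : Equiv.Perm (Fin n)) :
    MnS K K' η s t Q L N n (lam ∘ σ) = MnS K K' η s t Q L N n lam := by
  unfold MnS
  simp only [psiB_sym K K' η s t hτ, psiC_sym K K' η s t hτ]


/-- Lemma 1: the sum of norms of the Bethe vectors
`M_n(λ₁,…,λ_n) = (1/Q) Σ_{l=0}^{Q−1} ⟨Ψ_l^n(λ)|Ψ_l^n(λ)⟩` is a symmetric function of
the spectral parameters. -/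
theorem Mn_symmetric (K K' η s t : ℂ) (hτ : 0 < (Complex.I * K' / K).im)
    (Q : ℕ) (hQ : 0 < Q) (hη : (Q : ℂ) * η = 2 * K) (L N n : ℕ) (hL : Q ∣ L)
    (hN : Q ∣ 2 * N) (hn : n ≤ N) (lam : Fin n → ℂ) (σ : Equiv.Perm (Fin n)) :
    MnS K K' η s t Q L N n (lam ∘ σ) = MnS K K' η s t Q L N n lam := by
  exact MnS_sym K K' η s t hτ Q L N n lam σ

end
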